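/- Let q ≥ 1, S ≥ q be integers, h as specified, m ≥ 1 an integer, and let C = {ξ_1,…,ξ_M} ⊂ S^q admit an M–Z quadrature of order m with weights W. Let 0 < r ≤ S − q, let K' ⊂ K be concentric spherical caps (K' of strictly smaller radius), and let f ∈ C(S^q) with ‖f‖_{W_r(K)} = 1. Then there is a constant c > 0, depending only on q, h, r, the caps K, K', and the M–Z constant, such that for every integer n with 1 ≤ n ≤ m, sup_{x∈K'} |f(x) − σ_n(C,W;h;f,x)| ≤ c n^{−r}. -/

import Mathlib

noncomputable section

open MeasureTheory Finset

namespace SD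

/-- Euclidean space `ℝ^(q+1)`. -/
abbrev Euc (q : ℕ) := EuclideanSpace ℝ (Fin (q + 1))

/-- The unit sphere `S^q ⊂ ℝ^(q+1)`, as a type. -/
abbrev Sph (q : ℕ) : Type := Metric.sphere (0 : Euc q) 1

/-- Dot product of two points of the sphere. -/
def dot {q : ℕ} (x y : Sph q) : ℝ := ∑ i, (x : Euc q) i * (y : Euc q) i

/-- Geodesic distance `arccos (x ⬝ y)` on the sphere. -/
def gdist {q : ℕ} (x y : Sph q) : ℝ := Real.arccos (dot x y)

/-- The mesh norm `δ_C(S^q)` of a finite set of points. -/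
def meshNorm {q : ℕ} (C : Finset (Sph q)) : ℝ :=
  ⨆ x : Sph q, sInf ((fun ξ => gdist x ξ) '' (C : Set (Sph q)))

/-- `f : S^q → ℝ` belongs to `Π_n^q` : it is the restriction to the sphere of an algebraic
polynomial in `q+1` variables of total degree at most `n`. -/
def InPi (q n : ℕ) (f : Sph q → ℝ) : Prop :=
  ∃ P : MvPolynomial (Fin (q + 1)) ℝ, P.totalDegree ≤ n ∧
    ∀ x : Sph q, f x = MvPolynomial.eval (fun i => (x : Euc q) i) P

/-- `f` is a spherical harmonic of degree `ℓ` : the restriction to the sphere of a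
homogeneous harmonic polynomial of degree `ℓ`. -/
def IsSphHarm (q ℓ : ℕ) (f : Sph q → ℝ) : Prop :=
  ∃ P : MvPolynomial (Fin (q + 1)) ℝ, P.IsHomogeneous ℓ ∧
    (∑ i : Fin (q + 1), MvPolynomial.pderiv i (MvPolynomial.pderiv i P)) = 0 ∧
    ∀ x : Sph q, f x = MvPolynomial.eval (fun i => (x : Euc q) i) P

/-- Rotation of a point of the sphere by a linear isometry of the ambient space. -/
def rotate {q : ℕ} (R : Euc q ≃ₗᵢ[ℝ] Euc q) (x : Sph q) : Sph q :=
  ⟨R x, by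
    have hx : ‖(x : Euc q)‖ = 1 := mem_sphere_zero_iff_norm.mp x.2
    simp [mem_sphere_zero_iff_norm, hx]⟩

/-- `μ` is invariant under all rotations of the sphere. -/
def RotInvariant (q : ℕ) (μ : Measure (Sph q)) : Prop :=
  ∀ R : Euc q ≃ₗᵢ[ℝ] Euc q, Measure.map (rotate R) μ = μ

/-- `IterIntBV S f` : `f` is an `S` times iterated integral of a function of bounded
variation (on `[0,∞)`). -/
def IterIntBV : ℕ → (ℝ → ℝ) → Prop
  | 0, f => BoundedVariationOn f (Set.Ici 0)
  | (S + 1), f => ∃ g : ℝ → ℝ, IterIntBV S g ∧ ∀ x : ℝ, 0 ≤ x → f x = f 0 + ∫ t in (0 : ℝ)..x, g t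

/-- The standing hypotheses on the filter function `h` : `h = 1` on `[0,1/2]`, `h = 0` on
`(1,∞)`, `h` nonincreasing on `[0,∞)`, and `h` an `S` times iterated integral of a function
of bounded variation. -/
def GoodH (S : ℕ) (h : ℝ → ℝ) : Prop :=
  (∀ x : ℝ, 0 ≤ x → x ≤ 1 / 2 → h x = 1) ∧
  (∀ x : ℝ, 1 < x → h x = 0) ∧
  (∀ x y : ℝ, 0 ≤ x → x ≤ y → h y ≤ h x) ∧
  IterIntBV S h

/-- `Y ℓ ·` is, for each `ℓ`, an orthonormal basis of the space of degree `ℓ` spherical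
harmonics in `L²(μ)`. -/
def GoodBasis (q : ℕ) (μ : Measure (Sph q)) (d : ℕ → ℕ)
    (Y : (ℓ : ℕ) → Fin (d ℓ) → Sph q → ℝ) : Prop :=
  (∀ ℓ k, IsSphHarm q ℓ (Y ℓ k)) ∧
  (∀ (ℓ ℓ' : ℕ) (k : Fin (d ℓ)) (k' : Fin (d ℓ')),
      ∫ x, Y ℓ k x * Y ℓ' k' x ∂μ = if ℓ = ℓ' ∧ (k : ℕ) = (k' : ℕ) then 1 else 0) ∧
  (∀ (ℓ : ℕ) (f : Sph q → ℝ), IsSphHarm q ℓ f →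
      ∃ a : Fin (d ℓ) → ℝ, ∀ x, f x = ∑ k, a k * Y ℓ k x)

/-- The kernel `Φ_n(h; x·ξ) = Σ_{ℓ=0}^n h(ℓ/n) Σ_k Y_{ℓ,k}(x) Y_{ℓ,k}(ξ)`. -/
def Phi {q : ℕ} (d : ℕ → ℕ) (Y : (ℓ : ℕ) → Fin (d ℓ) → Sph q → ℝ) (h : ℝ → ℝ) (n : ℕ)
    (x ξ : Sph q) : ℝ :=
  ∑ ℓ ∈ range (n + 1), h ((ℓ : ℝ) / (n : ℝ)) * ∑ k, Y ℓ k x * Y ℓ k ξ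

/-- The discretized operator `σ_n(C, W; h; Z, x) = Σ_{ξ∈C} w_ξ z_ξ Φ_n(h; x·ξ)`. -/
def sigmaOp {q : ℕ} (d : ℕ → ℕ) (Y : (ℓ : ℕ) → Fin (d ℓ) → Sph q → ℝ) (h : ℝ → ℝ) (n : ℕ)
    (C : Finset (Sph q)) (w : Sph q → ℝ) (z : Sph q → ℝ) (x : Sph q) : ℝ :=
  ∑ ξ ∈ C, w ξ * z ξ * Phi d Y h n x ξ

/-- The summability operator `σ*_n(h; f, x) = ∫ f(ζ) Φ_n(h; x·ζ) dμ(ζ)`. -/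
def sigmaStar {q : ℕ} (μ : Measure (Sph q)) (d : ℕ → ℕ)
    (Y : (ℓ : ℕ) → Fin (d ℓ) → Sph q → ℝ) (h : ℝ → ℝ) (n : ℕ) (f : Sph q → ℝ)
    (x : Sph q) : ℝ :=
  ∫ ζ, f ζ * Phi d Y h n x ζ ∂μ

/-- Sup norm on the sphere. -/
def supNorm {q : ℕ} (f : Sph q → ℝ) : ℝ := ⨆ x : Sph q, |f x|

/-- Sup norm on a subset of the sphere. -/
def supNormOn {q : ℕ} (K : Set (Sph q)) (f : Sph q → ℝ) : ℝ := ⨆ x ∈ K, |f x|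

/-- The spherical cap of radius `δ` centered at `x₀`. -/
def cap {q : ℕ} (x₀ : Sph q) (δ : ℝ) : Set (Sph q) := {x | gdist x x₀ ≤ δ}

/-- `C` admits a Marcinkiewicz–Zygmund quadrature of order `m` with weights `w` and
M–Z constant `c₀`. -/
def MZQuad (q : ℕ) (μ : Measure (Sph q)) (m : ℕ) (C : Finset (Sph q)) (w : Sph q → ℝ)
    (c₀ : ℝ) : Prop :=
  (∀ P : Sph q → ℝ, InPi q (2 * m) P → ∑ ξ ∈ C, w ξ * P ξ = ∫ x, P x ∂μ) ∧
  (∀ P : Sph q → ℝ, InPi q (2 * m) P → ∀ p : ℝ, 1 ≤ p →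
      (∑ ξ ∈ C, |w ξ| * |P ξ| ^ p) ^ (1 / p) ≤ c₀ * (∫ x, |P x| ^ p ∂μ) ^ (1 / p))

/-- The sequence `n ↦ 2^((n+1)r) ‖σ*_{2^(n+1)}(h;f) − σ*_{2^n}(h;f)‖_{∞,K}`. -/
def WrSeqOn {q : ℕ} (K : Set (Sph q)) (μ : Measure (Sph q)) (d : ℕ → ℕ)
    (Y : (ℓ : ℕ) → Fin (d ℓ) → Sph q → ℝ) (h : ℝ → ℝ) (r : ℝ) (f : Sph q → ℝ) (n : ℕ) : ℝ :=
  (2 : ℝ) ^ (((n : ℝ) + 1) * r) *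
    supNormOn K (fun x => sigmaStar μ d Y h (2 ^ (n + 1)) f x - sigmaStar μ d Y h (2 ^ n) f x)

/-- The norm `‖f‖_{W_r(K)}`. -/
def WrNormOn {q : ℕ} (K : Set (Sph q)) (μ : Measure (Sph q)) (d : ℕ → ℕ)
    (Y : (ℓ : ℕ) → Fin (d ℓ) → Sph q → ℝ) (h : ℝ → ℝ) (r : ℝ) (f : Sph q → ℝ) : ℝ :=
  supNorm f + ⨆ n : ℕ, WrSeqOn K μ d Y h r f n

/-- The norm `‖f‖_{W_r}`. -/
def WrNorm {q : ℕ} (μ : Measure (Sph q)) (d : ℕ → ℕ)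
    (Y : (ℓ : ℕ) → Fin (d ℓ) → Sph q → ℝ) (h : ℝ → ℝ) (r : ℝ) (f : Sph q → ℝ) : ℝ :=
  WrNormOn Set.univ μ d Y h r f

/-- Membership in `W_r(K)` : `f` is continuous and the `W_r(K)` seminorm is finite. -/
def MemWrOn {q : ℕ} (K : Set (Sph q)) (μ : Measure (Sph q)) (d : ℕ → ℕ)
    (Y : (ℓ : ℕ) → Fin (d ℓ) → Sph q → ℝ) (h : ℝ → ℝ) (r : ℝ) (f : Sph q → ℝ) : Prop :=
  Continuous f ∧ BddAbove (Set.range (WrSeqOn K μ d Y h r f))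

/-- `y` is an orthonormal basis of `Π_n^q` in `L²(μ)` (so `N = dim Π_n^q`), whose `0`-th
element is the constant polynomial `1`. -/
def GoodPolyBasis (q n N : ℕ) (μ : Measure (Sph q)) (y : Fin N → Sph q → ℝ) : Prop :=
  (∀ i, InPi q n (y i)) ∧
  (∀ i j, ∫ x, y i x * y j x ∂μ = if i = j then 1 else 0) ∧
  (∀ P : Sph q → ℝ, InPi q n P → ∃ a : Fin N → ℝ, ∀ x, P x = ∑ i, a i * y i x) ∧
  (∀ i : Fin N, (i : ℕ) = 0 → ∀ x, y i x = 1)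

/-- The Gram matrix `(G_N)_{i,j} = Σ_{ξ∈C} v_ξ y_i(ξ) y_j(ξ)`. -/
def gram {q N : ℕ} (C : Finset (Sph q)) (v : Sph q → ℝ) (y : Fin N → Sph q → ℝ) :
    Matrix (Fin N) (Fin N) ℝ :=
  Matrix.of fun i j => ∑ ξ ∈ C, v ξ * y i ξ * y j ξ

/-- The least squares quadrature weights `w_ξ^{LSQ} = v_ξ Σ_k (G_N⁻¹)_{i₀,k} y_k(ξ)`. -/
def wLSQ {q N : ℕ} (C : Finset (Sph q)) (v : Sph q → ℝ) (y : Fin N → Sph q → ℝ) (i0 : Fin N)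
    (ξ : Sph q) : ℝ :=
  v ξ * ∑ k, (gram C v y)⁻¹ i0 k * y k ξ

/-- Two–sided Marcinkiewicz–Zygmund inequalities for the masses `v` on `C`, for all
`1 ≤ p ≤ ∞`. -/
def VMZ (q n : ℕ) (μ : Measure (Sph q)) (C : Finset (Sph q)) (v : Sph q → ℝ)
    (c₁ c₂ : ℝ) : Prop :=
  (∀ P : Sph q → ℝ, InPi q n P → ∀ p : ℝ, 1 ≤ p →
      c₁ * (∫ x, |P x| ^ p ∂μ) ^ (1 / p) ≤ (∑ ξ ∈ C, v ξ * |P ξ| ^ p) ^ (1 / p) ∧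
      (∑ ξ ∈ C, v ξ * |P ξ| ^ p) ^ (1 / p) ≤ c₂ * (∫ x, |P x| ^ p ∂μ) ^ (1 / p)) ∧
  (∀ P : Sph q → ℝ, InPi q n P →
      c₁ * supNorm P ≤ (⨆ ξ ∈ (C : Set (Sph q)), |P ξ|) ∧
      (⨆ ξ ∈ (C : Set (Sph q)), |P ξ|) ≤ c₂ * supNorm P)


/-- The Gegenbauer polynomials `C_n^{(q+1)/2}(t)`. -/
def gegU (q : ℕ) (t : ℝ) : ℕ → ℝ
  | 0 => 1
  | 1 => (q + 1) * t
  | (n + 2) => ((2 * n + q + 3) * t * gegU q t (n + 1) - (n + 1 + q) * gegU q t n) / (n + 2)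

/-- The zonal reproducing kernel of degree `n` spherical harmonics on `S^q`, as a function
of the dot product. -/
def zonal (q : ℕ) (t : ℝ) : ℕ → ℝ
  | 0 => 1
  | 1 => (q + 1) * t
  | (n + 2) => gegU q t (n + 2) - gegU q t n

lemma gegU_rec (q : ℕ) (t : ℝ) (n : ℕ) :
    (n + 2 : ℝ) * gegU q t (n + 2) =
      (2 * n + q + 3) * t * gegU q t (n + 1) - (n + 1 + q) * gegU q t n := by
  have : (n + 2 : ℝ) ≠ 0 := by positivity
  rw [gegU]; field_simp

/-- The geometric series `1 / (1 - X)`. -/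
abbrev geom : PowerSeries ℝ := PowerSeries.mk 1

lemma geom_mul_one_sub : geom * (1 - PowerSeries.X) = 1 :=
  PowerSeries.mk_one_mul_one_sub_eq_one ℝ

lemma coeff_geom_mul (f : PowerSeries ℝ) (n : ℕ) :
    PowerSeries.coeff n (geom * f) = ∑ k ∈ range (n + 1), PowerSeries.coeff k f := by
  rw [mul_comm, PowerSeries.coeff_mul, Finset.Nat.sum_antidiagonal_eq_sum_range_succ_mk]
  simp

lemma derivative_geom : PowerSeries.derivative ℝ geom = geom ^ 2 := by
  have h := congrArg (PowerSeries.derivative ℝ) geom_mul_one_sub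
  rw [Derivation.leibniz, map_sub, PowerSeries.derivative_one, PowerSeries.derivative_X] at h
  simp only [smul_eq_mul] at h
  linear_combination geom * h - (PowerSeries.derivative ℝ geom) * geom_mul_one_sub

lemma derivative_geom_pow (a : ℕ) :
    PowerSeries.derivative ℝ (geom ^ a) = (a : PowerSeries ℝ) * geom * geom ^ a := by
  rw [PowerSeries.derivative_pow, derivative_geom]
  rcases a with _ | a
  · simp
  · simp only [Nat.add_sub_cancel]; ring

/-- The power series `∑ cos ((k+1)θ) X^k`. -/
def cosSeries (θ : ℝ) : PowerSeries ℝ := PowerSeries.mk fun k => Real.cos ((k + 1) * θ)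

/-- Generating function of the Gegenbauer polynomials. -/
def gegSeries (q : ℕ) (t : ℝ) : PowerSeries ℝ := PowerSeries.mk (gegU q t)

/-- Generating function of the zonal kernels. -/
def zonalSeries (q : ℕ) (t : ℝ) : PowerSeries ℝ := PowerSeries.mk (zonal q t)

lemma zonalSeries_eq (q : ℕ) (t : ℝ) :
    zonalSeries q t = (1 - PowerSeries.X) * (1 + PowerSeries.X) * gegSeries q t := by
  have : (1 - PowerSeries.X) * (1 + PowerSeries.X) * gegSeries q t =
      gegSeries q t - PowerSeries.X ^ 2 * gegSeries q t := by ring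
  rw [this]
  ext n
  rcases n with _ | _ | n
  · simp [zonalSeries, gegSeries, zonal, gegU]
  · simp [zonalSeries, gegSeries, zonal, gegU, PowerSeries.coeff_X_pow_mul']
  · simp [PowerSeries.coeff_X_pow_mul', zonalSeries, gegSeries, zonal]

/-- The power series `1 - a X + X ^ 2`. -/
def quad (a : ℝ) : PowerSeries ℝ := 1 - PowerSeries.C a * PowerSeries.X + PowerSeries.X ^ 2

lemma quad_mul (a : ℝ) (f : PowerSeries ℝ) :
    quad a * f = f - PowerSeries.C a * (PowerSeries.X * f) + PowerSeries.X ^ 2 * f := by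
  rw [quad]; ring

lemma coeff_zero_quad_mul (a : ℝ) (f : PowerSeries ℝ) :
    PowerSeries.coeff 0 (quad a * f) = PowerSeries.coeff 0 f := by
  simp [quad_mul]

lemma coeff_one_quad_mul (a : ℝ) (f : PowerSeries ℝ) :
    PowerSeries.coeff 1 (quad a * f) = PowerSeries.coeff 1 f - a * PowerSeries.coeff 0 f := by
  rw [quad_mul, map_add, map_sub, PowerSeries.coeff_C_mul, PowerSeries.coeff_X_pow_mul',
    PowerSeries.coeff_succ_X_mul]
  simp

lemma coeff_add_two_quad_mul (a : ℝ) (f : PowerSeries ℝ) (n : ℕ) :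
    PowerSeries.coeff (n + 2) (quad a * f) = PowerSeries.coeff (n + 2) f -
      a * PowerSeries.coeff (n + 1) f + PowerSeries.coeff n f := by
  rw [quad_mul, map_add, map_sub, PowerSeries.coeff_C_mul, PowerSeries.coeff_X_pow_mul',
    PowerSeries.coeff_succ_X_mul]
  simp

lemma quad_mul_derivative_gegSeries (q : ℕ) (t : ℝ) :
    quad (2 * t) * PowerSeries.derivative ℝ (gegSeries q t) =
      PowerSeries.C (q + 1 : ℝ) *
        (PowerSeries.C t * gegSeries q t - PowerSeries.X * gegSeries q t) := by
  ext n
  rw [PowerSeries.coeff_C_mul, map_sub, PowerSeries.coeff_C_mul]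
  rcases n with _ | _ | n
  · rw [coeff_zero_quad_mul, PowerSeries.coeff_derivative, PowerSeries.coeff_zero_X_mul]
    simp [gegSeries, gegU]
  · have h := gegU_rec q t 0
    rw [coeff_one_quad_mul, PowerSeries.coeff_succ_X_mul]
    simp only [PowerSeries.coeff_derivative, gegSeries, PowerSeries.coeff_mk]
    simp only [gegU] at h ⊢
    push_cast at h ⊢
    linear_combination h
  · have h := gegU_rec q t (n + 1)
    rw [coeff_add_two_quad_mul, PowerSeries.coeff_succ_X_mul]
    simp only [PowerSeries.coeff_derivative, gegSeries, PowerSeries.coeff_mk]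
    push_cast at h ⊢
    linear_combination h

lemma quad_mul_cosSeries (θ : ℝ) :
    quad (2 * Real.cos θ) * cosSeries θ = PowerSeries.C (Real.cos θ) - PowerSeries.X := by
  ext n
  rcases n with _ | _ | n
  · rw [coeff_zero_quad_mul]
    simp [cosSeries]
  · rw [coeff_one_quad_mul]
    simp only [cosSeries, PowerSeries.coeff_mk, map_sub, PowerSeries.coeff_C]
    rw [Nat.cast_one, one_add_one_eq_two, Real.cos_two_mul]
    simp
    ring
  · rw [coeff_add_two_quad_mul]
    simp only [cosSeries, PowerSeries.coeff_mk, map_sub, PowerSeries.coeff_C, PowerSeries.coeff_X]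
    have h1 : (((n + 2 : ℕ) : ℝ) + 1) * θ = (n + 2) * θ + θ := by push_cast; ring
    have h2 : ((n : ℝ) + 1) * θ = (n + 2) * θ - θ := by ring
    have h3 : (((n + 1 : ℕ) : ℝ) + 1) * θ = (n + 2) * θ := by push_cast; ring
    rw [h1, h2, h3, Real.cos_add, Real.cos_sub]
    simp
    ring

lemma derivative_gegSeries (q : ℕ) (θ : ℝ) :
    PowerSeries.derivative ℝ (gegSeries q (Real.cos θ)) =
      PowerSeries.C (q + 1 : ℝ) * (cosSeries θ * gegSeries q (Real.cos θ)) := by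
  have hD : quad (2 * Real.cos θ) ≠ 0 := by
    intro h
    have := congrArg (PowerSeries.coeff 0) h
    simp [quad] at this
  apply mul_left_cancel₀ hD
  rw [quad_mul_derivative_gegSeries]
  linear_combination (-PowerSeries.C (q + 1 : ℝ) * gegSeries q (Real.cos θ)) *
    quad_mul_cosSeries θ

lemma coeff_succ_of_derivative_eq {F J : PowerSeries ℝ} {c : ℝ}
    (h : PowerSeries.derivative ℝ F = PowerSeries.C c * (J * F)) (n : ℕ) :
    PowerSeries.coeff (n + 1) F * (n + 1) =
      c * ∑ k ∈ range (n + 1), PowerSeries.coeff k J * PowerSeries.coeff (n - k) F := by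
  have := congrArg (PowerSeries.coeff n) h
  rwa [PowerSeries.coeff_derivative, PowerSeries.coeff_C_mul, PowerSeries.coeff_mul,
    Finset.Nat.sum_antidiagonal_eq_sum_range_succ_mk] at this

/-- Majorant principle for solutions of `F' = c J F`. -/
lemma abs_coeff_le_of_derivative_eq {F G J L : PowerSeries ℝ} {c : ℝ} (hc : 0 ≤ c)
    (hF : PowerSeries.derivative ℝ F = PowerSeries.C c * (J * F))
    (hG : PowerSeries.derivative ℝ G = PowerSeries.C c * (L * G))
    (hJL : ∀ n, |PowerSeries.coeff n J| ≤ PowerSeries.coeff n L)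
    (h0 : |PowerSeries.coeff 0 F| ≤ PowerSeries.coeff 0 G) (n : ℕ) :
    |PowerSeries.coeff n F| ≤ PowerSeries.coeff n G := by
  induction n using Nat.strong_induction_on with
  | _ n ih =>
    rcases n with _ | n
    · exact h0
    · have hn : (0 : ℝ) < n + 1 := by positivity
      rw [← mul_le_mul_iff_left₀ hn, coeff_succ_of_derivative_eq hG]
      nth_rewrite 1 [← abs_of_pos hn]
      rw [← abs_mul, coeff_succ_of_derivative_eq hF, abs_mul, abs_of_nonneg hc]
      refine mul_le_mul_of_nonneg_left ((abs_sum_le_sum_abs _ _).trans (sum_le_sum ?_)) hc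
      intro k hk
      rw [abs_mul]
      have h1 := ih (n - k) (by omega)
      exact mul_le_mul (hJL k) h1 (abs_nonneg _) ((abs_nonneg _).trans (hJL k))

lemma coeff_nonneg_of_derivative_eq {F J : PowerSeries ℝ} {c : ℝ} (hc : 0 ≤ c)
    (hF : PowerSeries.derivative ℝ F = PowerSeries.C c * (J * F))
    (hJ : ∀ n, 0 ≤ PowerSeries.coeff n J)
    (h0 : 0 ≤ PowerSeries.coeff 0 F) (n : ℕ) : 0 ≤ PowerSeries.coeff n F :=
  (abs_nonneg _).trans (abs_coeff_le_of_derivative_eq hc hF hF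
    (fun n => (abs_of_nonneg (hJ n)).le) (abs_of_nonneg h0).le n)

lemma abs_coeff_geom_pow_mul_le {f : PowerSeries ℝ} {b : ℕ}
    (hf : ∀ n : ℕ, |PowerSeries.coeff n f| ≤ ((n : ℝ) + 1) ^ b) (a n : ℕ) :
    |PowerSeries.coeff n (geom ^ a * f)| ≤ ((n : ℝ) + 1) ^ (a + b) := by
  induction a generalizing n with
  | zero => simpa using hf n
  | succ a ih =>
    rw [pow_succ', mul_assoc, coeff_geom_mul]
    refine (abs_sum_le_sum_abs _ _).trans ((sum_le_card_nsmul _ _ (((n : ℝ) + 1) ^ (a + b))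
      ?_).trans ?_)
    · intro k hk
      refine (ih k).trans (pow_le_pow_left₀ (by positivity) ?_ _)
      have : k ≤ n := by simpa [Nat.lt_succ_iff] using hk
      have : (k : ℝ) ≤ n := by exact_mod_cast this
      linarith
    · rw [card_range, nsmul_eq_mul]
      push_cast
      exact le_of_eq (by ring)

lemma coeff_geom_pow_succ_le (a n : ℕ) :
    PowerSeries.coeff n (geom ^ (a + 1)) ≤ ((n : ℝ) + 1) ^ a := by
  have := abs_coeff_geom_pow_mul_le (f := geom) (b := 0) (by simp) a n
  rw [pow_succ]
  exact (le_abs_self _).trans this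

lemma abs_gegU_le (q : ℕ) {t : ℝ} (ht : |t| ≤ 1) (n : ℕ) :
    |gegU q t n| ≤ ((n : ℝ) + 1) ^ q := by
  obtain ⟨h1, h2⟩ := abs_le.mp ht
  have ht' : t = Real.cos (Real.arccos t) := (Real.cos_arccos h1 h2).symm
  have hG : PowerSeries.derivative ℝ (geom ^ (q + 1)) =
      PowerSeries.C (q + 1 : ℝ) * (geom * geom ^ (q + 1)) := by
    rw [derivative_geom_pow]; simp [mul_assoc]
  have := abs_coeff_le_of_derivative_eq (c := q + 1) (by positivity)
    (derivative_gegSeries q (Real.arccos t)) hG (by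
      intro n; simpa [cosSeries] using Real.abs_cos_le_one _) (by simp [gegSeries, gegU]) n
  rw [← ht'] at this
  refine le_trans ?_ (this.trans (coeff_geom_pow_succ_le q n))
  simp [gegSeries]

/-- Positivity of the Cesàro kernels of order `q + 1`. -/
lemma coeff_geom_pow_mul_zonalSeries_nonneg (q : ℕ) {t : ℝ} (ht : |t| ≤ 1) (n : ℕ) :
    0 ≤ PowerSeries.coeff n (geom ^ (q + 2) * zonalSeries q t) := by
  obtain ⟨h1, h2⟩ := abs_le.mp ht
  have ht' : t = Real.cos (Real.arccos t) := (Real.cos_arccos h1 h2).symm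
  have e : geom ^ (q + 2) * zonalSeries q t =
      (1 + PowerSeries.X) * (geom ^ (q + 1) * gegSeries q t) := by
    rw [zonalSeries_eq]
    linear_combination (geom ^ (q + 1) * (1 + PowerSeries.X) * gegSeries q t) * geom_mul_one_sub
  have hA : ∀ n, 0 ≤ PowerSeries.coeff n (geom ^ (q + 1) * gegSeries q t) := by
    rw [ht']
    refine coeff_nonneg_of_derivative_eq (c := q + 1)
      (J := geom + cosSeries (Real.arccos t)) (by positivity) ?_ ?_ ?_
    · rw [Derivation.leibniz, derivative_gegSeries, derivative_geom_pow]
      simp only [smul_eq_mul, map_add, map_natCast, map_one, Nat.cast_add, Nat.cast_one]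
      ring
    · intro n
      have := Real.neg_one_le_cos ((n + 1) * Real.arccos t)
      simp only [cosSeries, map_add, PowerSeries.coeff_mk, Pi.one_apply]
      linarith
    · simp [gegSeries, gegU]
  rw [e, add_mul, one_mul, map_add]
  refine add_nonneg (hA n) ?_
  rcases n with _ | n
  · simp
  · rw [PowerSeries.coeff_succ_X_mul]; exact hA n

/-- A family of sequences `G n` all of whose differences of order `j ≤ J` satisfy weighted
`ℓ¹` bounds of order `n ^ (i - min (p + j) S)`, for every weight `(ℓ + 1) ^ i`. -/
def DiffBound (S p J : ℕ) (G : ℕ → ℕ → ℝ) : Prop :=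
  ∀ j ≤ J, ∀ i : ℤ, ∃ c : ℝ, ∀ n : ℕ, 1 ≤ n → ∀ N : ℕ,
    ∑ ℓ ∈ range N, ((ℓ : ℝ) + 1) ^ i * |(fwdDiff 1)^[j] (G n) ℓ| ≤
      c * (n : ℝ) ^ (i - (min (p + j) S : ℕ))

/-- Decay of the initial terms of a family of sequences faster than any power of `n`. -/
def RapidAtZero (G : ℕ → ℕ → ℝ) : Prop :=
  ∀ i : ℤ, ∃ c : ℝ, ∀ n : ℕ, 1 ≤ n → |G n 0| ≤ c * (n : ℝ) ^ i

lemma add_one_zpow_le (i : ℤ) : ∃ c : ℝ, 0 ≤ c ∧ ∀ ℓ : ℕ,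
    ((ℓ : ℝ) + 1) ^ i ≤ c * ((ℓ : ℝ) + 1 + 1) ^ i ∧
    ((ℓ : ℝ) + 1 + 1) ^ i ≤ c * ((ℓ : ℝ) + 1) ^ i := by
  have h1 : ∀ ℓ : ℕ, (1 : ℝ) ≤ ℓ + 1 := fun ℓ => by simp
  rcases le_total 0 i with hi | hi
  · lift i to ℕ using hi
    refine ⟨2 ^ i, by positivity, fun ℓ => ?_⟩
    simp only [zpow_natCast, ← mul_pow]
    have := h1 ℓ
    exact ⟨pow_le_pow_left₀ (by linarith) (by linarith) _,
      pow_le_pow_left₀ (by linarith) (by linarith) _⟩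
  · obtain ⟨k, rfl⟩ : ∃ k : ℕ, i = -k := ⟨i.natAbs, by omega⟩
    refine ⟨2 ^ k, by positivity, fun ℓ => ?_⟩
    have := h1 ℓ
    have ha : (0 : ℝ) < ℓ + 1 := by positivity
    have hb : (0 : ℝ) < (ℓ : ℝ) + 1 + 1 := by positivity
    simp only [zpow_neg, zpow_natCast, ← div_eq_mul_inv]
    rw [inv_eq_one_div, inv_eq_one_div, div_le_div_iff₀ (by positivity) (by positivity),
      div_le_div_iff₀ (by positivity) (by positivity), one_mul, one_mul, ← mul_pow, ← mul_pow]
    exact ⟨pow_le_pow_left₀ (by linarith) (by linarith) _,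
      pow_le_pow_left₀ (by linarith) (by linarith) _⟩

lemma zpow_le_zpow_cast {n : ℕ} (hn : 1 ≤ n) {a b : ℤ} (h : a ≤ b) : (n : ℝ) ^ a ≤ (n : ℝ) ^ b :=
  zpow_le_zpow_right₀ (by exact_mod_cast hn) h

namespace DiffBound

variable {S p J : ℕ} {G G' : ℕ → ℕ → ℝ}

lemma le_mul_zpow {a c : ℝ} {n : ℕ} (hn : 1 ≤ n) {i k : ℤ} (ha : 0 ≤ a)
    (h : a ≤ c * (n : ℝ) ^ i) (hik : i ≤ k) : a ≤ c * (n : ℝ) ^ k := by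
  have hn' : (0 : ℝ) < n := by exact_mod_cast hn
  have hc : 0 ≤ c := by
    by_contra! hc
    have := mul_neg_of_neg_of_pos hc (zpow_pos hn' i)
    linarith
  exact h.trans (mul_le_mul_of_nonneg_left (zpow_le_zpow_cast hn hik) hc)

lemma sum_nonneg' (i : ℤ) (f : ℕ → ℝ) (N : ℕ) :
    0 ≤ ∑ ℓ ∈ range N, ((ℓ : ℝ) + 1) ^ i * |f ℓ| :=
  sum_nonneg fun _ _ => by positivity

lemma add (h : DiffBound S p J G) (h' : DiffBound S p J G') :
    DiffBound S p J (fun n ℓ => G n ℓ + G' n ℓ) := by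
  intro j hj i
  obtain ⟨c, hc⟩ := h j hj i
  obtain ⟨c', hc'⟩ := h' j hj i
  refine ⟨c + c', fun n hn N => ?_⟩
  rw [add_mul]
  refine le_trans ?_ (add_le_add (hc n hn N) (hc' n hn N))
  rw [← sum_add_distrib]
  refine sum_le_sum fun ℓ _ => ?_
  rw [← mul_add]
  change _ * |(fwdDiff 1)^[j] (G n + G' n) ℓ| ≤ _
  rw [fwdDiff_iter_add]
  exact mul_le_mul_of_nonneg_left (abs_add_le _ _) (by positivity)

lemma const_mul (a : ℝ) (h : DiffBound S p J G) :
    DiffBound S p J (fun n ℓ => a * G n ℓ) := by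
  intro j hj i
  obtain ⟨c, hc⟩ := h j hj i
  refine ⟨|a| * c, fun n hn N => ?_⟩
  rw [mul_assoc]
  refine le_trans (le_of_eq ?_) (mul_le_mul_of_nonneg_left (hc n hn N) (abs_nonneg a))
  rw [mul_sum]
  refine sum_congr rfl fun ℓ _ => ?_
  change _ * |(fwdDiff 1)^[j] (a • G n) ℓ| = _
  rw [fwdDiff_iter_const_smul]
  simp [abs_mul]
  ring

lemma diff (h : DiffBound S p (J + 1) G) :
    DiffBound S (p + 1) J (fun n => fwdDiff 1 (G n)) := by
  intro j hj i
  obtain ⟨c, hc⟩ := h (j + 1) (by omega) i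
  refine ⟨c, fun n hn N => ?_⟩
  have := hc n hn N
  rwa [show p + (j + 1) = p + 1 + j by ring] at this

lemma of_diff (h0 : DiffBound S p 0 G) (h : DiffBound S (p + 1) J (fun n => fwdDiff 1 (G n))) :
    DiffBound S p (J + 1) G := by
  intro j hj i
  rcases j with _ | j
  · exact h0 0 le_rfl i
  · obtain ⟨c, hc⟩ := h j (by omega) i
    refine ⟨c, fun n hn N => ?_⟩
    have := hc n hn N
    rwa [show p + 1 + j = p + (j + 1) by ring] at this

lemma shift (h : DiffBound S p J G) : DiffBound S p J (fun n ℓ => G n (ℓ + 1)) := by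
  intro j hj i
  obtain ⟨c, hc⟩ := h j hj i
  obtain ⟨b, hb0, hb⟩ := add_one_zpow_le i
  refine ⟨b * c, fun n hn N => ?_⟩
  rw [mul_assoc]
  refine le_trans ?_ (mul_le_mul_of_nonneg_left (hc n hn (N + 1)) hb0)
  rw [sum_range_succ', mul_add, mul_sum]
  refine le_trans (sum_le_sum fun ℓ _ => ?_) (le_add_of_nonneg_right (by positivity))
  rw [fwdDiff_iter_comp_add, ← mul_assoc]
  refine mul_le_mul_of_nonneg_right ?_ (abs_nonneg _)
  have := (hb ℓ).1
  push_cast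
  exact this

lemma rapidAtZero (h : DiffBound S p J G) : RapidAtZero G := by
  intro i
  obtain ⟨c, hc⟩ := h 0 (Nat.zero_le _) i
  refine ⟨c, fun n hn => ?_⟩
  have := hc n hn 1
  simp only [sum_range_one, Nat.cast_zero, zero_add, one_zpow, one_mul,
    Function.iterate_zero, id] at this
  exact le_mul_zpow hn (abs_nonneg _) this (by omega)

lemma of_shift (h0 : RapidAtZero G) (h : DiffBound S p J (fun n ℓ => G n (ℓ + 1))) :
    DiffBound S p J G := by
  have base : ∀ (p : ℕ) (G : ℕ → ℕ → ℝ), RapidAtZero G →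
      DiffBound S p 0 (fun n ℓ => G n (ℓ + 1)) → DiffBound S p 0 G := by
    intro p G h0 h j hj i
    obtain rfl : j = 0 := by omega
    obtain ⟨c, hc⟩ := h 0 le_rfl i
    obtain ⟨a, ha⟩ := h0 (i - (min (p + 0) S : ℕ))
    obtain ⟨b, hb0, hb⟩ := add_one_zpow_le i
    refine ⟨b * c + a, fun n hn N => ?_⟩
    refine le_trans (sum_le_sum_of_subset_of_nonneg (range_mono (Nat.le_succ N))
      fun _ _ _ => by positivity) ?_
    rw [sum_range_succ', add_mul, mul_assoc]
    refine add_le_add ?_ (by simpa using ha n hn)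
    refine le_trans ?_ (mul_le_mul_of_nonneg_left (hc n hn N) hb0)
    rw [mul_sum]
    refine sum_le_sum fun ℓ _ => ?_
    rw [← mul_assoc]
    refine mul_le_mul_of_nonneg_right ?_ (abs_nonneg _)
    have := (hb ℓ).2
    push_cast
    exact this
  induction J generalizing p G with
  | zero => exact base p G h0 h
  | succ J ih =>
    refine of_diff (base p G h0 fun j hj => h j (by omega)) (ih ?_ ?_)
    · intro i
      obtain ⟨a, ha⟩ := h0 i
      obtain ⟨b, hb⟩ := h.rapidAtZero i
      refine ⟨b + a, fun n hn => ?_⟩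
      rw [add_mul]
      exact (abs_sub _ _).trans (add_le_add (hb n hn) (ha n hn))
    · exact h.diff

lemma mul_inv {x : ℝ} (hx : 0 < x) (h : DiffBound S p J G) :
    DiffBound S (p + 1) J (fun n ℓ => ((ℓ : ℝ) + x)⁻¹ * G n ℓ) := by
  have base : ∀ (p : ℕ) (x : ℝ), 0 < x → ∀ G : ℕ → ℕ → ℝ, DiffBound S p 0 G →
      DiffBound S (p + 1) 0 (fun n ℓ => ((ℓ : ℝ) + x)⁻¹ * G n ℓ) := by
    intro p x hx G h j hj i
    obtain rfl : j = 0 := by omega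
    obtain ⟨c, hc⟩ := h 0 le_rfl (i - 1)
    refine ⟨(1 + x⁻¹) * c, fun n hn N => ?_⟩
    refine le_mul_zpow hn (sum_nonneg' _ _ _) (i := i - 1 - (min (p + 0) S : ℕ)) ?_ (by omega)
    rw [mul_assoc]
    refine le_trans ?_ (mul_le_mul_of_nonneg_left (hc n hn N) (by positivity))
    rw [mul_sum]
    refine sum_le_sum fun ℓ _ => ?_
    simp only [Function.iterate_zero, id, abs_mul]
    have hl : (0 : ℝ) < ℓ + 1 := by positivity
    rw [← mul_assoc, ← mul_assoc, zpow_sub_one₀ hl.ne']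
    refine mul_le_mul_of_nonneg_right ?_ (abs_nonneg _)
    have hlx : (0 : ℝ) < ℓ + x := by positivity
    rw [abs_of_pos (inv_pos.mpr hlx), mul_left_comm]
    refine mul_le_mul_of_nonneg_left ?_ (by positivity)
    rw [inv_eq_one_div, inv_eq_one_div, inv_eq_one_div, mul_one_div, div_le_div_iff₀ hlx hl]
    have : (0 : ℝ) ≤ ℓ / x := by positivity
    have e : (1 + 1 / x) * ((ℓ : ℝ) + x) = ℓ + x + ℓ / x + 1 := by field_simp; ring
    rw [e]; linarith
  induction J generalizing p x G with
  | zero => exact base p x hx G h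
  | succ J ih =>
    have h' : DiffBound S p J G := fun j hj => h j (by omega)
    refine of_diff (base p x hx G fun j hj => h j (by omega)) ?_
    have key := (ih (x := x + 1) (by positivity) h.diff).add
      ((ih hx (ih (x := x + 1) (by positivity) h')).const_mul (-1))
    convert key using 3 with n ℓ
    have h1 : (ℓ : ℝ) + x ≠ 0 := by positivity
    have h2 : (ℓ : ℝ) + (x + 1) ≠ 0 := by positivity
    have h3 : ((ℓ + 1 : ℕ) : ℝ) + x = ℓ + (x + 1) := by push_cast; ring
    simp only [fwdDiff]
    rw [h3]
    field_simp
    ring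

end DiffBound

/-- The action of multiplication by `1 - t` on the coefficients of Gegenbauer expansions. -/
def lapSeq (q : ℕ) (G : ℕ → ℝ) : ℕ → ℝ
  | 0 => G 0 - (q + 1) / (q + 3) * G 1
  | (ℓ + 1) => G (ℓ + 1) - (ℓ + 1) / (2 * ℓ + q + 1) * G ℓ -
      (ℓ + 2 + q) / (2 * ℓ + q + 5) * G (ℓ + 2)

lemma sum_lapSeq (q : ℕ) (t : ℝ) (G : ℕ → ℝ) (N : ℕ) :
    (1 - t) * ∑ ℓ ∈ range (N + 1), G ℓ * gegU q t ℓ =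
      ∑ ℓ ∈ range (N + 1), lapSeq q G ℓ * gegU q t ℓ
        - (N + 1) / (2 * N + q + 1) * G N * gegU q t (N + 1)
        + (N + 1 + q) / (2 * N + q + 3) * G (N + 1) * gegU q t N := by
  induction N with
  | zero =>
    have h1 : (q : ℝ) + 1 ≠ 0 := by positivity
    have h2 : (q : ℝ) + 3 ≠ 0 := by positivity
    simp [lapSeq, gegU]
    field_simp
    ring
  | succ N ih =>
    rw [sum_range_succ, mul_add, ih, sum_range_succ (n := N + 1)]
    have h := gegU_rec q t N
    have h2 : (2 * N + q + 3 : ℝ) ≠ 0 := by positivity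
    have h3 : (2 * N + q + 1 : ℝ) ≠ 0 := by positivity
    have h4 : (2 * N + q + 5 : ℝ) ≠ 0 := by positivity
    have h5 : t * gegU q t (N + 1) = ((N + 2) * gegU q t (N + 2) + (N + 1 + q) * gegU q t N) /
        (2 * N + q + 3) := by
      field_simp; linear_combination -h
    have h6 : (1 - t) * (G (N + 1) * gegU q t (N + 1)) =
        G (N + 1) * (gegU q t (N + 1) - t * gegU q t (N + 1)) := by ring
    rw [h6, h5, lapSeq]
    push_cast
    have e1 : (2 * ((N : ℝ) + 1) + q + 1) = 2 * N + q + 3 := by ring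
    have e2 : (2 * ((N : ℝ) + 1) + q + 3) = 2 * N + q + 5 := by ring
    have e3 : N + 1 + 1 = N + 2 := rfl
    rw [e1, e2, e3]
    field_simp
    ring

lemma pow_mul_sum_gegU (q : ℕ) (t : ℝ) (G : ℕ → ℝ) (N k : ℕ) (hG : ∀ ℓ, N ≤ ℓ → G ℓ = 0) :
    (∀ ℓ, N + k ≤ ℓ → (lapSeq q)^[k] G ℓ = 0) ∧
    (1 - t) ^ k * ∑ ℓ ∈ range N, G ℓ * gegU q t ℓ =
      ∑ ℓ ∈ range (N + k), (lapSeq q)^[k] G ℓ * gegU q t ℓ := by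
  induction k with
  | zero => simpa using hG
  | succ k ih =>
    obtain ⟨h1, h2⟩ := ih
    constructor
    · intro ℓ hℓ
      rw [Function.iterate_succ_apply']
      obtain ⟨m, rfl⟩ : ∃ m, ℓ = m + 1 := ⟨ℓ - 1, by omega⟩
      simp [lapSeq, h1 (m + 1) (by omega), h1 m (by omega), h1 (m + 2) (by omega)]
    · have h3 := sum_lapSeq q t ((lapSeq q)^[k] G) (N + k)
      rw [sum_range_succ, h1 (N + k) le_rfl, h1 (N + k + 1) (by omega)] at h3
      rw [pow_succ', mul_assoc, h2, Function.iterate_succ_apply', ← add_assoc]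
      simpa using h3

lemma DiffBound.lapSeq {S p J : ℕ} {G : ℕ → ℕ → ℝ} (q : ℕ) (h : DiffBound S p (J + 2) G) :
    DiffBound S (p + 2) J (fun n => lapSeq q (G n)) := by
  have h0 := h.rapidAtZero
  have h1 := h.shift.rapidAtZero
  refine DiffBound.of_shift ?_ ?_
  · intro i
    obtain ⟨a, ha⟩ := h0 i
    obtain ⟨b, hb⟩ := h1 i
    refine ⟨a + b, fun n hn => ?_⟩
    rw [add_mul]
    refine (abs_sub _ _).trans (add_le_add (ha n hn) ?_)
    rw [abs_mul]
    refine le_trans (mul_le_of_le_one_left (abs_nonneg _) ?_) (hb n hn)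
    rw [abs_of_nonneg (by positivity), div_le_one (by positivity)]
    linarith
  · have hq : (0 : ℝ) < (q + 1) / 2 := by positivity
    have hm : DiffBound S (p + 2) J
        (fun n => fwdDiff 1 (fun ℓ => ((ℓ : ℝ) + (q + 1) / 2)⁻¹ * G n ℓ)) :=
      fun j hj => (DiffBound.mul_inv hq h).diff j (by omega)
    have key := (h.diff.diff.const_mul (-(1 / 2))).add
      ((hm.add hm.shift).const_mul (-((q - 1) / 4)))
    convert key using 3 with n ℓ
    have e1 : ((ℓ + 1 : ℕ) : ℝ) = ℓ + 1 := by push_cast; ring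
    have e2 : ((ℓ + 1 + 1 : ℕ) : ℝ) = ℓ + 2 := by push_cast; ring
    have h2 : (2 * ℓ + q + 5 : ℝ) ≠ 0 := by positivity
    have h3 : (2 * ℓ + q + 1 : ℝ) ≠ 0 := by positivity
    have h4 : (2 * ℓ + q + 3 : ℝ) ≠ 0 := by positivity
    have f1 : ((ℓ : ℝ) + (q + 1) / 2)⁻¹ = 2 / (2 * ℓ + q + 1) := by
      rw [inv_eq_one_div, div_eq_div_iff (by positivity) h3]; ring
    have f2 : ((ℓ : ℝ) + 1 + (q + 1) / 2)⁻¹ = 2 / (2 * ℓ + q + 3) := by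
      rw [inv_eq_one_div, div_eq_div_iff (by positivity) h4]; ring
    have f3 : ((ℓ : ℝ) + 2 + (q + 1) / 2)⁻¹ = 2 / (2 * ℓ + q + 5) := by
      rw [inv_eq_one_div, div_eq_div_iff (by positivity) h2]; ring
    simp only [fwdDiff, SD.lapSeq]
    rw [e1, e2, f1, f2, f3]
    field_simp
    ring

lemma DiffBound.iterate_lapSeq {S : ℕ} {G : ℕ → ℕ → ℝ} (q : ℕ) (h : ∀ J, DiffBound S 0 J G)
    (k : ℕ) : ∀ J, DiffBound S (2 * k) J (fun n => (SD.lapSeq q)^[k] (G n)) := by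
  induction k with
  | zero => simpa using h
  | succ k ih =>
    intro J
    have := (ih (J + 2)).lapSeq q
    simp only [Function.iterate_succ_apply']
    exact this

lemma sum_zonal_eq (q : ℕ) (t : ℝ) (H : ℕ → ℝ) (N : ℕ) (hH : ∀ ℓ, N ≤ ℓ → H ℓ = 0) :
    ∑ ℓ ∈ range N, H ℓ * zonal q t ℓ = ∑ ℓ ∈ range N, (H ℓ - H (ℓ + 2)) * gegU q t ℓ := by
  have key : ∀ M, ∑ ℓ ∈ range (M + 2), H ℓ * zonal q t ℓ =
      ∑ ℓ ∈ range M, (H ℓ - H (ℓ + 2)) * gegU q t ℓ +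
        H M * gegU q t M + H (M + 1) * gegU q t (M + 1) := by
    intro M
    induction M with
    | zero => simp [sum_range_succ, zonal, gegU]
    | succ M ih =>
      rw [sum_range_succ, ih, sum_range_succ (n := M), zonal]
      ring
  have := key N
  rw [sum_range_succ, sum_range_succ, hH N le_rfl, hH (N + 1) (by omega)] at this
  simpa using this

/-- Off-diagonal decay of summability kernels. -/
theorem exists_pow_mul_sum_zonal_le {S : ℕ} (q : ℕ) (H : ℕ → ℕ → ℝ)
    (hH : ∀ n ℓ, n < ℓ → H n ℓ = 0) (h : ∀ J, DiffBound S 0 J fun n => fwdDiff 1 (H n)) :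
    ∃ c : ℝ, ∀ n : ℕ, 1 ≤ n → ∀ t : ℝ, |t| ≤ 1 →
      (1 - t) ^ S * |∑ ℓ ∈ range (n + 1), H n ℓ * zonal q t ℓ| ≤ c * (n : ℝ) ^ ((q : ℤ) - S) := by
  have hG : ∀ J, DiffBound S 0 J fun n ℓ => H n ℓ - H n (ℓ + 2) := by
    intro J
    have := ((h J).add (h J).shift).const_mul (-1)
    convert this using 3 with n ℓ
    simp only [fwdDiff]
    ring_nf
  obtain ⟨c, hc⟩ := DiffBound.iterate_lapSeq q hG S 0 0 le_rfl q
  refine ⟨c, fun n hn t ht => ?_⟩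
  have h1 := (pow_mul_sum_gegU q t (fun ℓ => H n ℓ - H n (ℓ + 2)) (n + 1) S (by
    intro ℓ hℓ
    simp [hH n ℓ (by omega), hH n (ℓ + 2) (by omega)])).2
  have h1t : 0 ≤ 1 - t := by linarith [(abs_le.mp ht).2]
  rw [sum_zonal_eq q t _ _ fun ℓ hℓ => hH n ℓ (by omega)]
  nth_rewrite 1 [← abs_of_nonneg (pow_nonneg h1t S)]
  rw [← abs_mul, h1]
  have h2 := hc n hn (n + 1 + S)
  rw [show min (2 * S + 0) S = S by omega] at h2
  refine le_trans ?_ h2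
  refine (abs_sum_le_sum_abs _ _).trans (sum_le_sum fun ℓ _ => ?_)
  rw [abs_mul, mul_comm, zpow_natCast]
  exact mul_le_mul_of_nonneg_right (abs_gegU_le q ht ℓ) (abs_nonneg _)

lemma sum_mul_coeff_eq (f : PowerSeries ℝ) (H : ℕ → ℝ) (N : ℕ) (hH : ∀ ℓ, N ≤ ℓ → H ℓ = 0)
    (a : ℕ) : ∑ ℓ ∈ range N, H ℓ * PowerSeries.coeff ℓ f =
      (-1) ^ a * ∑ ℓ ∈ range N, (fwdDiff 1)^[a] H ℓ * PowerSeries.coeff ℓ (geom ^ a * f) := by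
  induction a generalizing H with
  | zero => simp
  | succ a ih =>
    have key : ∀ (g : PowerSeries ℝ) (H : ℕ → ℝ) (M : ℕ),
        ∑ ℓ ∈ range M, H ℓ * PowerSeries.coeff ℓ g =
        -∑ ℓ ∈ range M, fwdDiff 1 H ℓ * PowerSeries.coeff ℓ (geom * g) +
          H M * ∑ ℓ ∈ range M, PowerSeries.coeff ℓ g := by
      intro g H M
      induction M with
      | zero => simp
      | succ M ihM =>
        simp only [sum_range_succ _ M, ihM, coeff_geom_mul, fwdDiff]
        ring
    have hd : ∀ (a : ℕ) ℓ, N ≤ ℓ → (fwdDiff 1)^[a] H ℓ = 0 := by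
      intro a
      induction a with
      | zero => exact hH
      | succ a iha =>
        intro ℓ hℓ
        rw [Function.iterate_succ_apply', fwdDiff, iha _ (by omega), iha _ hℓ, sub_zero]
    rw [ih H hH, key, hd a N le_rfl, zero_mul, add_zero, Function.iterate_succ_apply', pow_succ,
      pow_succ' geom, mul_assoc geom]
    ring

lemma IterIntBV.bounded_and_integrable {S : ℕ} {f : ℝ → ℝ} (hf : IterIntBV S f) {R : ℝ}
    (hR : 0 ≤ R) :
    (∃ M, ∀ x ∈ Set.Icc 0 R, |f x| ≤ M) ∧ IntervalIntegrable f volume 0 R := by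
  induction S generalizing f with
  | zero =>
    constructor
    · refine ⟨|f 0| + (eVariationOn f (Set.Ici 0)).toReal, fun x hx => ?_⟩
      have h1 := BoundedVariationOn.dist_le hf (x := x) (y := 0) hx.1 (Set.self_mem_Ici)
      rw [Real.dist_eq] at h1
      have h2 := abs_sub_abs_le_abs_sub (f x) (f 0)
      linarith
    · obtain ⟨a, b, ha, hb, rfl⟩ :=
        hf.locallyBoundedVariationOn.exists_monotoneOn_sub_monotoneOn
      have hs : Set.uIcc 0 R ⊆ Set.Ici 0 := by
        rw [Set.uIcc_of_le hR]; exact Set.Icc_subset_Ici_self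
      exact (ha.mono hs).intervalIntegrable.sub (hb.mono hs).intervalIntegrable
  | succ S ih =>
    obtain ⟨g, hg, hfg⟩ := hf
    have hc : ContinuousOn f (Set.uIcc 0 R) := by
      have h1 := intervalIntegral.continuousOn_primitive_interval' (ih hg).2 (Set.left_mem_uIcc)
      refine ((continuousOn_const (c := f 0)).add h1).congr fun x hx => ?_
      rw [Set.uIcc_of_le hR] at hx
      exact hfg x hx.1
    refine ⟨?_, hc.intervalIntegrable⟩
    rw [Set.uIcc_of_le hR] at hc
    exact isCompact_Icc.exists_bound_of_continuousOn hc

lemma IterIntBV.intervalIntegrable {S : ℕ} {f : ℝ → ℝ} (hf : IterIntBV S f) {a b : ℝ}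
    (ha : 0 ≤ a) (hb : 0 ≤ b) : IntervalIntegrable f volume a b :=
  (hf.bounded_and_integrable ha).2.symm.trans (hf.bounded_and_integrable hb).2

lemma intervalIntegrable_iterate_fwdDiff {g : ℝ → ℝ} {η : ℝ} (hη : 0 ≤ η)
    (hg : ∀ a b : ℝ, 0 ≤ a → 0 ≤ b → IntervalIntegrable g volume a b) (j : ℕ) {a b : ℝ}
    (ha : 0 ≤ a) (hb : 0 ≤ b) : IntervalIntegrable ((fwdDiff η)^[j] g) volume a b := by
  induction j generalizing a b with
  | zero => exact hg a b ha hb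
  | succ j ih =>
    rw [Function.iterate_succ']
    have h1 := (ih (a := a + η) (b := b + η) (by positivity) (by positivity)).comp_add_right η
    simp only [add_sub_cancel_right] at h1
    exact h1.sub (ih ha hb)

lemma iterate_fwdDiff_eq_integral {f g : ℝ → ℝ} {η : ℝ} (hη : 0 ≤ η)
    (hg : ∀ a b : ℝ, 0 ≤ a → 0 ≤ b → IntervalIntegrable g volume a b)
    (hfg : ∀ x : ℝ, 0 ≤ x → f x = f 0 + ∫ t in (0 : ℝ)..x, g t) (j : ℕ) {x : ℝ} (hx : 0 ≤ x) :
    (fwdDiff η)^[j + 1] f x = ∫ u in (0 : ℝ)..η, (fwdDiff η)^[j] g (x + u) := by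
  induction j generalizing x with
  | zero =>
    have h1 := intervalIntegral.integral_interval_sub_left (hg 0 (x + η) le_rfl (by positivity))
      (hg 0 x le_rfl hx)
    simp only [zero_add, Function.iterate_one, fwdDiff, Function.iterate_zero, id]
    rw [hfg x hx, hfg (x + η) (by positivity), intervalIntegral.integral_comp_add_left]
    simp only [add_zero]
    linarith
  | succ j ih =>
    rw [Function.iterate_succ_apply', fwdDiff, ih hx, ih (by positivity : 0 ≤ x + η),
      ← intervalIntegral.integral_sub]
    · refine intervalIntegral.integral_congr fun u _ => ?_
      simp only [Function.iterate_succ_apply', fwdDiff]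
      rw [add_right_comm]
    · have := (intervalIntegrable_iterate_fwdDiff hη hg j (a := x + η) (b := x + η + η)
        (by positivity) (by positivity)).comp_add_left (x + η)
      simpa using this
    · have := (intervalIntegrable_iterate_fwdDiff hη hg j (a := x) (b := x + η)
        (by positivity) (by positivity)).comp_add_left x
      simpa using this

lemma sum_abs_iterate_fwdDiff_le {f g : ℝ → ℝ} {η : ℝ} (hη : 0 < η)
    (hg : ∀ a b : ℝ, 0 ≤ a → 0 ≤ b → IntervalIntegrable g volume a b)
    (hfg : ∀ x : ℝ, 0 ≤ x → f x = f 0 + ∫ t in (0 : ℝ)..x, g t) {s : ℝ} (hs : 0 ≤ s) (k N : ℕ)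
    {B : ℝ}
    (hB : ∀ u ∈ Set.Icc 0 η, ∑ ℓ ∈ range N, |(fwdDiff η)^[k] g (ℓ * η + (s + u))| ≤ B) :
    ∑ ℓ ∈ range N, |(fwdDiff η)^[k + 1] f (ℓ * η + s)| ≤ B * η := by
  have hint : ∀ ℓ : ℕ, IntervalIntegrable (fun u => |(fwdDiff η)^[k] g (ℓ * η + s + u)|)
      volume 0 η := by
    intro ℓ
    have := ((intervalIntegrable_iterate_fwdDiff hη.le hg k (a := ℓ * η + s)
      (b := ℓ * η + s + η) (by positivity) (by positivity)).comp_add_left (ℓ * η + s)).abs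
    simpa using this
  calc ∑ ℓ ∈ range N, |(fwdDiff η)^[k + 1] f (ℓ * η + s)|
      ≤ ∑ ℓ ∈ range N, ∫ u in (0 : ℝ)..η, |(fwdDiff η)^[k] g (ℓ * η + s + u)| := by
        refine sum_le_sum fun ℓ _ => ?_
        rw [iterate_fwdDiff_eq_integral hη.le hg hfg k (by positivity)]
        exact intervalIntegral.abs_integral_le_integral_abs hη.le
    _ = ∫ u in (0 : ℝ)..η, ∑ ℓ ∈ range N, |(fwdDiff η)^[k] g (ℓ * η + s + u)| :=
        (intervalIntegral.integral_finsetSum fun ℓ _ => hint ℓ).symm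
    _ ≤ ∫ u in (0 : ℝ)..η, B := by
        refine intervalIntegral.integral_mono_on hη.le
          ?_ (by simp) fun u hu => ?_
        · have := IntervalIntegrable.sum (range N) fun ℓ _ => hint ℓ
          rwa [show (∑ ℓ ∈ range N, fun u => |(fwdDiff η)^[k] g (ℓ * η + s + u)|) =
            fun u => ∑ ℓ ∈ range N, |(fwdDiff η)^[k] g (ℓ * η + s + u)| by
              funext u; simp] at this
        · simpa only [add_assoc] using hB u hu
    _ = B * η := by simp [mul_comm]

lemma IterIntBV.exists_sum_abs_fwdDiff_le {S : ℕ} {f : ℝ → ℝ} (hf : IterIntBV S f) {j : ℕ}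
    (hj : j ≤ S) (R : ℝ) : ∃ c : ℝ, ∀ η : ℝ, 0 < η → ∀ s : ℝ, 0 ≤ s → ∀ N : ℕ,
      s + (N + j) * η ≤ R → ∑ ℓ ∈ range N, |(fwdDiff η)^[j + 1] f (ℓ * η + s)| ≤ c * η ^ j := by
  induction S generalizing f j R with
  | zero =>
    obtain rfl : j = 0 := by omega
    refine ⟨(eVariationOn f (Set.Ici 0)).toReal, fun η hη s hs N _ => ?_⟩
    have h1 := eVariationOn.sum_le (f := f) (s := Set.Ici 0) (n := N)
      (u := fun ℓ : ℕ => (ℓ : ℝ) * η + s)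
      (fun a b hab => by dsimp only; gcongr) (fun i => by
        simp only [Set.mem_Ici]; positivity)
    have h2 := ENNReal.toReal_mono hf h1
    rw [ENNReal.toReal_sum fun _ _ => edist_ne_top _ _] at h2
    simp only [pow_zero, mul_one]
    refine le_trans (le_of_eq (sum_congr rfl fun ℓ _ => ?_)) h2
    rw [edist_dist, ENNReal.toReal_ofReal dist_nonneg, Real.dist_eq]
    simp only [zero_add, Function.iterate_one, fwdDiff]
    push_cast
    ring_nf
  | succ S ih =>
    obtain ⟨g, hg, hfg⟩ := hf
    have hgi : ∀ a b : ℝ, 0 ≤ a → 0 ≤ b → IntervalIntegrable g volume a b :=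
      fun a b => hg.intervalIntegrable
    rcases j with _ | j
    · obtain ⟨M, hM⟩ := (hg.bounded_and_integrable (le_max_left 0 R)).1
      have hM0 : 0 ≤ M := (abs_nonneg _).trans (hM 0 ⟨le_rfl, le_max_left _ _⟩)
      refine ⟨M * max 0 R, fun η hη s hs N hN => ?_⟩
      have hNη : (N : ℝ) * η + s ≤ max 0 R := by
        refine le_trans ?_ (le_max_right 0 R)
        simpa [add_comm] using hN
      have := sum_abs_iterate_fwdDiff_le hη hgi hfg hs 0 N (B := N * M) fun u hu => by
        refine (sum_le_card_nsmul _ _ M fun ℓ hℓ => ?_).trans (by simp)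
        refine hM _ ⟨by have := hu.1; positivity, le_trans ?_ hNη⟩
        have hℓN : (ℓ : ℝ) + 1 ≤ N := by exact_mod_cast mem_range.mp hℓ
        have := mul_le_mul_of_nonneg_right hℓN hη.le
        linarith [hu.2]
      refine this.trans ?_
      have h3 : (N : ℝ) * η ≤ max 0 R := by linarith
      have := mul_le_mul_of_nonneg_left h3 hM0
      simp only [pow_zero, mul_one]
      linarith
    · obtain ⟨c, hc⟩ := ih hg (Nat.le_of_succ_le_succ hj) R
      refine ⟨c, fun η hη s hs N hN => ?_⟩
      rw [pow_succ, ← mul_assoc]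
      refine sum_abs_iterate_fwdDiff_le hη hgi hfg hs (j + 1) N fun u hu => ?_
      refine hc η hη (s + u) (add_nonneg hs hu.1) N (le_trans ?_ hN)
      push_cast
      linarith [hu.2]

lemma iterate_fwdDiff_one_comp (f : ℝ → ℝ) (η : ℝ) (j ℓ : ℕ) :
    (fwdDiff 1)^[j] (fun k : ℕ => f (k * η)) ℓ = (fwdDiff η)^[j] f (ℓ * η) := by
  induction j generalizing ℓ with
  | zero => rfl
  | succ j ih =>
    simp only [Function.iterate_succ_apply', fwdDiff, ih]
    push_cast
    ring_nf

lemma iterate_fwdDiff_one_eq_zero (H : ℕ → ℝ) (j ℓ : ℕ) (a : ℝ)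
    (hH : ∀ k, ℓ ≤ k → k ≤ ℓ + j + 1 → H k = a) : (fwdDiff 1)^[j + 1] H ℓ = 0 := by
  induction j generalizing ℓ with
  | zero => simp [fwdDiff, hH ℓ le_rfl (by omega), hH (ℓ + 1) (by omega) (by omega)]
  | succ j ih =>
    rw [Function.iterate_succ_apply', fwdDiff, ih ℓ fun k h1 h2 => hH k h1 (by omega),
      ih (ℓ + 1) fun k h1 h2 => hH k (by omega) (by omega), sub_zero]

lemma zpow_le_of_le_of_le {a b B : ℝ} (ha : 0 < a) (hb : 0 < b) (hB : 1 ≤ B) (h1 : a ≤ B * b)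
    (h2 : b ≤ B * a) (i : ℤ) : a ^ i ≤ B ^ i.natAbs * b ^ i := by
  have hB0 : 0 < B := by linarith
  rcases le_total 0 i with hi | hi
  · lift i to ℕ using hi
    simp only [zpow_natCast, ← mul_pow, Int.natAbs_natCast]
    exact pow_le_pow_left₀ ha.le h1 _
  · obtain ⟨k, rfl⟩ : ∃ k : ℕ, i = -k := ⟨i.natAbs, by omega⟩
    simp only [zpow_neg, zpow_natCast, Int.natAbs_neg, Int.natAbs_natCast, ← div_eq_mul_inv]
    rw [inv_eq_one_div, div_le_div_iff₀ (by positivity) (by positivity), one_mul, ← mul_pow]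
    exact pow_le_pow_left₀ hb.le h2 _

lemma GoodH.exists_sum_abs_fwdDiff_le {S : ℕ} {h : ℝ → ℝ} (hh : GoodH S h) (j : ℕ) :
    ∃ c : ℝ, ∀ n : ℕ, 1 ≤ n → ∀ N : ℕ,
      ∑ ℓ ∈ range N, |(fwdDiff 1)^[j + 1] (fun k : ℕ => h (k / n)) ℓ| ≤
        c * (n : ℝ) ^ (-(min j S : ℕ) : ℤ) := by
  have base : ∀ j ≤ S, ∃ c : ℝ, ∀ n : ℕ, 1 ≤ n → ∀ N : ℕ,
      ∑ ℓ ∈ range N, |(fwdDiff 1)^[j + 1] (fun k : ℕ => h (k / n)) ℓ| ≤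
        c * (n : ℝ) ^ (-(min j S : ℕ) : ℤ) := by
    intro j hj
    obtain ⟨c, hc⟩ := hh.2.2.2.exists_sum_abs_fwdDiff_le hj (2 + j)
    refine ⟨c, fun n hn N => ?_⟩
    have hn0 : (0 : ℝ) < n := by exact_mod_cast hn
    have hn1 : (1 : ℝ) ≤ n := by exact_mod_cast hn
    have h1 := hc (n : ℝ)⁻¹ (by positivity) 0 le_rfl (n + 1) (by
      have hi : (n : ℝ)⁻¹ ≤ 1 := inv_le_one_of_one_le₀ hn1
      have : (j : ℝ) * (n : ℝ)⁻¹ ≤ j := mul_le_of_le_one_right (by positivity) hi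
      have e : (n : ℝ) * (n : ℝ)⁻¹ = 1 := mul_inv_cancel₀ hn0.ne'
      push_cast
      linarith)
    rw [min_eq_left hj, zpow_neg, zpow_natCast, ← inv_pow]
    refine le_trans ?_ h1
    simp only [div_eq_mul_inv, iterate_fwdDiff_one_comp, add_zero]
    have hz : ∀ ℓ : ℕ, n + 1 ≤ ℓ →
        |(fwdDiff (n : ℝ)⁻¹)^[j + 1] h (ℓ * (n : ℝ)⁻¹)| = 0 := by
      intro ℓ hℓ
      rw [← iterate_fwdDiff_one_comp, iterate_fwdDiff_one_eq_zero _ j ℓ 0, abs_zero]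
      intro k hk _
      refine hh.2.1 _ ?_
      rw [← div_eq_mul_inv, one_lt_div hn0]
      exact_mod_cast (by omega : n < k)
    rw [← sum_filter_add_sum_filter_not (range N) (fun ℓ => ℓ < n + 1),
      sum_eq_zero (s := {ℓ ∈ range N | ¬ℓ < n + 1}) fun ℓ hℓ =>
        hz ℓ (not_lt.mp (mem_filter.mp hℓ).2), add_zero]
    exact sum_le_sum_of_subset_of_nonneg
      (fun ℓ hℓ => mem_range.mpr (mem_filter.mp hℓ).2) fun _ _ _ => abs_nonneg _
  induction j with
  | zero => exact base 0 (Nat.zero_le _)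
  | succ j ih =>
    rcases le_or_gt (j + 1) S with hj | hj
    · exact base _ hj
    · obtain ⟨c, hc⟩ := ih
      refine ⟨2 * c, fun n hn N => ?_⟩
      rw [show min (j + 1) S = min j S by omega]
      set H := (fwdDiff 1)^[j + 1] (fun k : ℕ => h (k / n)) with hH
      have h1 : ∑ ℓ ∈ range N, |(fwdDiff 1)^[j + 1 + 1] (fun k : ℕ => h (k / n)) ℓ| ≤
          ∑ ℓ ∈ range N, |H (ℓ + 1)| + ∑ ℓ ∈ range N, |H ℓ| := by
        rw [← sum_add_distrib]
        refine sum_le_sum fun ℓ _ => ?_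
        rw [Function.iterate_succ_apply', ← hH, fwdDiff]
        exact abs_sub _ _
      have h2 := hc n hn (N + 1)
      have h3 := hc n hn N
      rw [sum_range_succ'] at h2
      have := abs_nonneg (H 0)
      linarith

lemma GoodH.diffBound {S : ℕ} {h : ℝ → ℝ} (hh : GoodH S h) (J : ℕ) :
    DiffBound S 0 J (fun n => fwdDiff 1 fun k : ℕ => h (k / n)) := by
  intro j _ i
  obtain ⟨c, hc⟩ := hh.exists_sum_abs_fwdDiff_le j
  set B : ℝ := 2 * (j + 1) with hB
  have hB1 : 1 ≤ B := by
    have : (0 : ℝ) ≤ j := by positivity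
    linarith
  refine ⟨B ^ i.natAbs * c, fun n hn N => ?_⟩
  have hn0 : (0 : ℝ) < n := by exact_mod_cast hn
  rw [zero_add, sub_eq_add_neg, zpow_add₀ hn0.ne', mul_mul_mul_comm]
  refine le_trans ?_ (mul_le_mul_of_nonneg_left (hc n hn N) (by positivity))
  rw [mul_sum]
  refine sum_le_sum fun ℓ _ => ?_
  rw [← Function.iterate_succ_apply]
  by_cases h0 : (fwdDiff 1)^[j + 1] (fun k : ℕ => h (k / n)) ℓ = 0
  · simp [h0]
  refine mul_le_mul_of_nonneg_right ?_ (abs_nonneg _)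
  have hl : ℓ ≤ n := by
    by_contra! hl
    refine h0 (iterate_fwdDiff_one_eq_zero _ j ℓ 0 fun k hk _ => hh.2.1 _ ?_)
    rw [one_lt_div hn0]
    exact_mod_cast (by omega : n < k)
  have hr : n ≤ 2 * (ℓ + j + 1) := by
    by_contra! hr
    refine h0 (iterate_fwdDiff_one_eq_zero _ j ℓ 1 fun k _ hk => hh.1 _ (by positivity) ?_)
    rw [div_le_div_iff₀ hn0 two_pos]
    exact_mod_cast (by omega : k * 2 ≤ 1 * n)
  have hn1 : (1 : ℝ) ≤ n := by exact_mod_cast hn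
  have hl' : (ℓ : ℝ) ≤ n := by exact_mod_cast hl
  have hr' : (n : ℝ) ≤ 2 * (ℓ + j + 1) := by exact_mod_cast hr
  have hj0 : (0 : ℝ) ≤ j := by positivity
  have hl0 : (0 : ℝ) ≤ ℓ := by positivity
  refine zpow_le_of_le_of_le (by positivity) hn0 hB1 ?_ ?_ i
  · nlinarith
  · nlinarith

section Laplacian

open MvPolynomial

lemma pderiv_comm {σ : Type*} (i j : σ) (P : MvPolynomial σ ℝ) :
    pderiv i (pderiv j P) = pderiv j (pderiv i P) := by
  classical
  have : ⁅(pderiv i : Derivation ℝ (MvPolynomial σ ℝ) (MvPolynomial σ ℝ)),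
      (pderiv j : Derivation ℝ (MvPolynomial σ ℝ) (MvPolynomial σ ℝ))⁆ = 0 := by
    refine derivation_ext fun k => ?_
    simp [Derivation.commutator_apply, pderiv_X, Pi.single_apply, apply_ite]
  have h := congrArg (fun D => D P) this
  simpa [Derivation.commutator_apply, sub_eq_zero] using h

variable {σ : Type*} [Fintype σ]

/-- The Laplacian of a polynomial. -/
def lap (P : MvPolynomial σ ℝ) : MvPolynomial σ ℝ := ∑ i, pderiv i (pderiv i P)

lemma lap_mul (A B : MvPolynomial σ ℝ) :
    lap (A * B) = A * lap B + 2 * ∑ i, pderiv i A * pderiv i B + lap A * B := by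
  simp only [lap, pderiv_mul, map_add, mul_sum, sum_mul, ← sum_add_distrib]
  exact sum_congr rfl fun i _ => by ring

lemma lap_sub (A B : MvPolynomial σ ℝ) : lap (A - B) = lap A - lap B := by
  simp [lap, sum_sub_distrib]

lemma lap_C_mul (a : ℝ) (A : MvPolynomial σ ℝ) : lap (C a * A) = C a * lap A := by
  simp [lap, mul_sum]

lemma lap_sum_C_mul_pderiv (b : σ → ℝ) (P : MvPolynomial σ ℝ) :
    lap (∑ j, C (b j) * pderiv j P) = ∑ j, C (b j) * pderiv j (lap P) := by
  simp only [lap, map_sum, pderiv_C_mul, mul_sum]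
  rw [sum_comm]
  refine sum_congr rfl fun j _ => sum_congr rfl fun i _ => ?_
  rw [pderiv_comm i j, pderiv_comm i j]

lemma pderiv_sum_C_mul_X (b : σ → ℝ) (i : σ) :
    pderiv i (∑ j, C (b j) * X j : MvPolynomial σ ℝ) = C (b i) := by
  classical
  simp [pderiv_X, Pi.single_apply, eq_comm]

lemma lap_sum_C_mul_X (b : σ → ℝ) : lap (∑ j, C (b j) * X j : MvPolynomial σ ℝ) = 0 := by
  simp only [lap, pderiv_sum_C_mul_X, pderiv_C, sum_const_zero]

lemma pderiv_sum_X_sq (i : σ) :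
    pderiv i (∑ j, X j ^ 2 : MvPolynomial σ ℝ) = 2 * X i := by
  classical
  simp [pderiv_X, Pi.single_apply, eq_comm]

lemma lap_sum_X_sq : lap (∑ j, X j ^ 2 : MvPolynomial σ ℝ) =
    C (2 * Fintype.card σ : ℝ) := by
  simp only [lap, pderiv_sum_X_sq]
  have : ∀ i : σ, pderiv i (2 * X i : MvPolynomial σ ℝ) = 2 := by
    intro i
    rw [show (2 : MvPolynomial σ ℝ) = C 2 from rfl, pderiv_C_mul, pderiv_X_self, mul_one]
  simp only [this, sum_const, card_univ, nsmul_eq_mul, map_mul, map_natCast]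
  exact mul_comm _ _

/-- The harmonic component of degree `ℓ + 1` of a linear form times a harmonic polynomial. -/
lemma lap_harmonic_projection {ℓ : ℕ} {P : MvPolynomial σ ℝ} (hP : P.IsHomogeneous (ℓ + 1))
    (hl : lap P = 0) (b : σ → ℝ) :
    lap ((∑ j, C (b j) * X j) * P - C (1 / (Fintype.card σ + 2 * ℓ : ℝ)) *
      ((∑ j, X j ^ 2) * ∑ j, C (b j) * pderiv j P)) = 0 := by
  set Q := ∑ j, C (b j) * pderiv j P with hQ
  have hQh : Q.IsHomogeneous ℓ := by
    refine IsHomogeneous.sum _ _ _ fun j _ => ?_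
    simpa using (isHomogeneous_C _ (b j)).mul hP.pderiv
  have hQl : lap Q = 0 := by simp [hQ, lap_sum_C_mul_pderiv, hl]
  have h1 : lap ((∑ j, C (b j) * X j) * P) = 2 * Q := by
    rw [lap_mul, hl, lap_sum_C_mul_X]
    simp only [pderiv_sum_C_mul_X, mul_zero, zero_mul, zero_add, add_zero, hQ]
  have h2 : lap ((∑ j, X j ^ 2) * Q) = C (2 * Fintype.card σ + 4 * ℓ : ℝ) * Q := by
    rw [lap_mul, hQl, lap_sum_X_sq]
    simp only [pderiv_sum_X_sq, mul_assoc, ← mul_sum, hQh.sum_X_mul_pderiv]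
    simp only [map_add, map_mul, nsmul_eq_mul, map_natCast]
    rw [show (C 2 : MvPolynomial σ ℝ) = 2 from rfl, show (C 4 : MvPolynomial σ ℝ) = 4 from rfl]
    ring
  rw [lap_sub, lap_C_mul, h1, h2, ← mul_assoc, ← map_mul]
  by_cases h0 : (Fintype.card σ + 2 * ℓ : ℝ) = 0
  · have : Fintype.card σ = 0 := by
      have := Nat.cast_nonneg (α := ℝ) (Fintype.card σ)
      have := Nat.cast_nonneg (α := ℝ) ℓ
      exact_mod_cast (by linarith : (Fintype.card σ : ℝ) = 0)
    have := Fintype.card_eq_zero_iff.mp this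
    simp [hQ]
  · rw [show 1 / (Fintype.card σ + 2 * ℓ : ℝ) * (2 * Fintype.card σ + 4 * ℓ) = 2 by
      field_simp; ring]
    rw [show (C 2 : MvPolynomial σ ℝ) = 2 from rfl, sub_self]

end Laplacian

section Sphere

variable {q : ℕ}

lemma dot_self (x : Sph q) : dot x x = 1 := by
  have hx : ‖(x : Euc q)‖ = 1 := mem_sphere_zero_iff_norm.mp x.2
  have := EuclideanSpace.real_norm_sq_eq (x : Euc q)
  rw [hx] at this
  simp only [dot, ← pow_two]
  linarith

lemma dot_comm (x y : Sph q) : dot x y = dot y x := by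
  simp only [dot, mul_comm]

lemma isSphHarm_zero (ℓ : ℕ) : IsSphHarm q ℓ 0 :=
  ⟨0, MvPolynomial.isHomogeneous_zero _ _ _, by simp, by simp⟩

/-- Multiplication by a linear form maps harmonics of degree `ℓ` to sums of harmonics of
degrees `ℓ + 1` and `ℓ - 1`. -/
lemma IsSphHarm.exists_linear_mul_eq {ℓ : ℕ} {f : Sph q → ℝ} (hf : IsSphHarm q ℓ f)
    (b : Fin (q + 1) → ℝ) : ∃ u v : Sph q → ℝ, IsSphHarm q (ℓ + 1) u ∧ IsSphHarm q (ℓ - 1) v ∧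
      (ℓ = 0 → v = 0) ∧ (∀ y : Sph q, (∑ i, b i * (y : Euc q) i) * f y = u y + v y) ∧
      ∀ y : Sph q, (∀ i, (y : Euc q) i = b i) → v y = ℓ / (2 * ℓ + q - 1) * f y := by
  obtain ⟨P, hP, hl, hfP⟩ := hf
  have hL : (∑ j, MvPolynomial.C (b j) * MvPolynomial.X j :
      MvPolynomial (Fin (q + 1)) ℝ).IsHomogeneous 1 := by
    refine MvPolynomial.IsHomogeneous.sum _ _ _ fun j _ => ?_
    simpa using (MvPolynomial.isHomogeneous_C _ (b j)).mul (MvPolynomial.isHomogeneous_X ℝ j)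
  rcases ℓ with _ | ℓ
  · obtain ⟨a, rfl⟩ : ∃ a, P = MvPolynomial.C a := by
      refine ⟨_, MvPolynomial.totalDegree_eq_zero_iff_eq_C.mp ?_⟩
      exact (MvPolynomial.totalDegree_zero_iff_isHomogeneous _).mpr hP
    refine ⟨fun y => (∑ i, b i * (y : Euc q) i) * f y, 0,
      ⟨(∑ j, MvPolynomial.C (b j) * MvPolynomial.X j) * MvPolynomial.C a, ?_, ?_, ?_⟩,
      isSphHarm_zero _, fun _ => rfl, by simp, by simp⟩
    · simpa using hL.mul hP
    · change lap _ = 0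
      rw [mul_comm, lap_C_mul, lap_sum_C_mul_X, mul_zero]
    · intro x; simp [hfP]
  · have hQh : (∑ j, MvPolynomial.C (b j) * MvPolynomial.pderiv j P).IsHomogeneous ℓ := by
      refine MvPolynomial.IsHomogeneous.sum _ _ _ fun j _ => ?_
      simpa using (MvPolynomial.isHomogeneous_C _ (b j)).mul hP.pderiv
    have hN : (∑ j, MvPolynomial.X j ^ 2 : MvPolynomial (Fin (q + 1)) ℝ).IsHomogeneous 2 :=
      MvPolynomial.IsHomogeneous.sum _ _ _ fun j _ => MvPolynomial.isHomogeneous_X_pow j 2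
    have hl' := lap_harmonic_projection hP hl b
    have hev : ∀ y : Sph q, MvPolynomial.eval (fun i => (y : Euc q) i)
        (∑ j, MvPolynomial.X j ^ 2 : MvPolynomial (Fin (q + 1)) ℝ) = 1 := by
      intro y
      simpa [dot, ← pow_two] using dot_self y
    have he := fun x : Sph q => congrArg (MvPolynomial.eval fun i => (x : Euc q) i)
      hP.sum_X_mul_pderiv
    set N := (∑ j, MvPolynomial.X j ^ 2 : MvPolynomial (Fin (q + 1)) ℝ)
    set c : ℝ := 1 / ((Fintype.card (Fin (q + 1)) : ℝ) + 2 * ℓ) with hc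
    set Q := ∑ j, MvPolynomial.C (b j) * MvPolynomial.pderiv j P with hQ
    refine ⟨_, fun y => MvPolynomial.eval (fun i => (y : Euc q) i) (MvPolynomial.C c * Q),
      ⟨_, ?_, hl', fun _ => rfl⟩, ⟨MvPolynomial.C c * Q, ?_, ?_, fun _ => rfl⟩, by simp, ?_, ?_⟩
    · refine (?_ : MvPolynomial.IsHomogeneous _ _).sub ?_
      · simpa [add_comm] using hL.mul hP
      · simpa [add_comm, add_left_comm] using
          (MvPolynomial.isHomogeneous_C _ c).mul (hN.mul hQh)
    · simpa using (MvPolynomial.isHomogeneous_C _ c).mul hQh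
    · change lap _ = 0
      rw [lap_C_mul, hQ, lap_sum_C_mul_pderiv]
      change _ * ∑ j, _ * MvPolynomial.pderiv j (∑ i, _) = 0
      simp [hl]
    · intro y
      simp only [map_sub, map_mul, map_sum, MvPolynomial.eval_C, MvPolynomial.eval_X, hfP, hev]
      ring
    · intro y hy
      have h1 := he y
      simp only [map_sum, map_mul, MvPolynomial.eval_X, nsmul_eq_mul, map_natCast, hy] at h1
      simp only [hQ, map_mul, map_sum, MvPolynomial.eval_C, hy, hfP]
      rw [h1, hc]
      simp only [Fintype.card_fin]
      push_cast
      rw [← mul_assoc]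
      congr 1
      rw [one_div_mul_eq_div]
      ring_nf

lemma IsSphHarm.sum_mul {ι : Type*} (s : Finset ι) {ℓ : ℕ} {F : ι → Sph q → ℝ} (a : ι → ℝ)
    (hF : ∀ k, IsSphHarm q ℓ (F k)) : IsSphHarm q ℓ (fun x => ∑ k ∈ s, a k * F k x) := by
  choose P hP hl hFP using hF
  refine ⟨∑ k ∈ s, MvPolynomial.C (a k) * P k, ?_, ?_, fun x => by simp [hFP]⟩
  · refine MvPolynomial.IsHomogeneous.sum _ _ _ fun k _ => ?_
    simpa using (MvPolynomial.isHomogeneous_C _ (a k)).mul (hP k)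
  · simp only [map_sum, MvPolynomial.pderiv_C_mul]
    rw [sum_comm]
    simp [← mul_sum, hl]

lemma continuous_eval_sphere (P : MvPolynomial (Fin (q + 1)) ℝ) :
    Continuous fun x : Sph q => MvPolynomial.eval (fun i => (x : Euc q) i) P :=
  (MvPolynomial.continuous_eval P).comp (by fun_prop)

lemma IsSphHarm.continuous {ℓ : ℕ} {f : Sph q → ℝ} (hf : IsSphHarm q ℓ f) : Continuous f := by
  obtain ⟨P, -, -, h⟩ := hf
  rw [funext h]
  exact continuous_eval_sphere P

lemma integrable_of_continuous (μ : Measure (Sph q)) [IsFiniteMeasure μ] {f : Sph q → ℝ}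
    (hf : Continuous f) : Integrable f μ :=
  hf.integrable_of_hasCompactSupport (HasCompactSupport.of_compactSpace f)

lemma continuous_dot_right (x : Sph q) : Continuous fun y => dot x y := by
  unfold dot; fun_prop

lemma abs_dot_le_one (x y : Sph q) : |dot x y| ≤ 1 := by
  have h1 : dot x y = inner ℝ (x : Euc q) (y : Euc q) := by
    simp [dot, PiLp.inner_apply, mul_comm]
  have h2 := abs_real_inner_le_norm (x : Euc q) (y : Euc q)
  rw [mem_sphere_zero_iff_norm.mp x.2, mem_sphere_zero_iff_norm.mp y.2] at h2
  rw [h1]; linarith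

/-- The reproducing kernel of spherical harmonics of degree `ℓ`. -/
def harmKernel {d : ℕ → ℕ} (Y : (ℓ : ℕ) → Fin (d ℓ) → Sph q → ℝ) (ℓ : ℕ) (x ξ : Sph q) : ℝ :=
  ∑ k, Y ℓ k x * Y ℓ k ξ

lemma harmKernel_comm {d : ℕ → ℕ} (Y : (ℓ : ℕ) → Fin (d ℓ) → Sph q → ℝ) (ℓ : ℕ) (x ξ : Sph q) :
    harmKernel Y ℓ x ξ = harmKernel Y ℓ ξ x := by
  simp only [harmKernel, mul_comm]

namespace GoodBasis

variable {μ : Measure (Sph q)} {d : ℕ → ℕ} {Y : (ℓ : ℕ) → Fin (d ℓ) → Sph q → ℝ}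

lemma continuous (hY : GoodBasis q μ d Y) (ℓ : ℕ) (k : Fin (d ℓ)) : Continuous (Y ℓ k) :=
  (hY.1 ℓ k).continuous

lemma isSphHarm_harmKernel (hY : GoodBasis q μ d Y) (ℓ : ℕ) (ξ : Sph q) :
    IsSphHarm q ℓ (fun x => harmKernel Y ℓ x ξ) := by
  have := IsSphHarm.sum_mul univ (fun k => Y ℓ k ξ) fun k => hY.1 ℓ k
  simpa only [harmKernel, mul_comm] using this

lemma dot_mul_harmKernel (hY : GoodBasis q μ d Y) (ℓ : ℕ) (ξ : Sph q) :
    ∃ u v : Sph q → ℝ, IsSphHarm q (ℓ + 1) u ∧ IsSphHarm q (ℓ - 1) v ∧ (ℓ = 0 → v = 0) ∧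
      (∀ y, dot ξ y * harmKernel Y ℓ y ξ = u y + v y) := by
  obtain ⟨u, v, hu, hv, h0, h, -⟩ :=
    (hY.isSphHarm_harmKernel ℓ ξ).exists_linear_mul_eq fun i => (ξ : Euc q) i
  exact ⟨u, v, hu, hv, h0, h⟩

variable [IsProbabilityMeasure μ]

lemma integral_mul_harmKernel (hY : GoodBasis q μ d Y) {ℓ : ℕ} {f : Sph q → ℝ}
    (hf : IsSphHarm q ℓ f) (j : ℕ) (ξ : Sph q) :
    ∫ x, f x * harmKernel Y j x ξ ∂μ = if ℓ = j then f ξ else 0 := by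
  obtain ⟨a, ha⟩ := hY.2.2 ℓ f hf
  have e : ∀ x, f x * harmKernel Y j x ξ =
      ∑ k, ∑ k', a k * Y j k' ξ * (Y ℓ k x * Y j k' x) := by
    intro x
    rw [ha, harmKernel, sum_mul_sum]
    exact sum_congr rfl fun k _ => sum_congr rfl fun k' _ => by ring
  simp only [e]
  have hi : ∀ k k', Integrable (fun x => a k * Y j k' ξ * (Y ℓ k x * Y j k' x)) μ :=
    fun k k' => integrable_of_continuous μ
      (continuous_const.mul ((hY.continuous ℓ k).mul (hY.continuous j k')))
  rw [integral_finsetSum _ fun k _ => integrable_finsetSum _ fun k' _ => hi k k']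
  simp only [fun k => integral_finsetSum univ fun k' _ => hi k k', integral_const_mul, hY.2.1]
  split_ifs with h
  · subst h
    rw [ha]
    refine sum_congr rfl fun k _ => ?_
    simp [← Fin.ext_iff]
  · simp [h]

lemma dot_mul_harmKernel_eq (hY : GoodBasis q μ d Y) (ℓ : ℕ) (x ξ : Sph q) :
    dot x ξ * harmKernel Y (ℓ + 1) x ξ =
      (ℓ + 2) / (2 * ℓ + q + 3) * harmKernel Y (ℓ + 2) x ξ +
        (1 - ℓ / (2 * ℓ + q - 1)) * harmKernel Y ℓ x ξ ∧
    dot x ξ * harmKernel Y 0 x ξ = 1 / (q + 1) * harmKernel Y 1 x ξ := by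
  have hc : ∀ ℓ ξ, Continuous fun x => harmKernel Y ℓ x ξ := fun ℓ ξ =>
    (hY.isSphHarm_harmKernel ℓ ξ).continuous
  have hrep : ∀ ℓ j : ℕ, ∀ u v : Sph q → ℝ, IsSphHarm q (ℓ + 1) u → IsSphHarm q (ℓ - 1) v →
      (ℓ = 0 → v = 0) → ∀ x,
      ∫ y, (u y + v y) * harmKernel Y j y x ∂μ =
        (if ℓ + 1 = j then u x else 0) + if ℓ = j + 1 then v x else 0 := by
    intro ℓ j u v hu hv h0 x
    have hi : ∀ u : Sph q → ℝ, Continuous u → Integrable (fun y => u y * harmKernel Y j y x) μ :=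
      fun u hu => integrable_of_continuous μ (hu.mul (hc j x))
    simp only [add_mul]
    rw [integral_add (hi u hu.continuous) (hi v hv.continuous),
      hY.integral_mul_harmKernel hu, hY.integral_mul_harmKernel hv]
    congr 1
    rcases Nat.eq_zero_or_pos ℓ with rfl | hl
    · simp [h0 rfl]
    · exact if_congr (by omega) rfl rfl
  have hswap : ∀ ℓ j : ℕ, ∫ y, (dot ξ y * harmKernel Y ℓ y ξ) * harmKernel Y j y x ∂μ =
      ∫ y, (dot ξ y * harmKernel Y j y x) * harmKernel Y ℓ y ξ ∂μ := fun ℓ j =>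
    integral_congr_ae (Filter.Eventually.of_forall fun y => by ring)
  have up : ∀ (ℓ : ℕ) (u v : Sph q → ℝ), IsSphHarm q (ℓ + 1) u → IsSphHarm q (ℓ - 1) v →
      (ℓ = 0 → v = 0) → (∀ y, dot ξ y * harmKernel Y ℓ y ξ = u y + v y) →
      u x = (ℓ + 1) / (2 * ℓ + q + 1) * harmKernel Y (ℓ + 1) x ξ := by
    intro ℓ u v hu hv h0 h
    obtain ⟨u', v', hu', hv', h0', h', h''⟩ :=
      (hY.isSphHarm_harmKernel (ℓ + 1) x).exists_linear_mul_eq fun i => (ξ : Euc q) i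
    have h1 := hrep ℓ (ℓ + 1) u v hu hv h0 x
    have h2 := hrep (ℓ + 1) ℓ u' v' hu' hv' h0' ξ
    simp only [← h] at h1
    simp only [← h'] at h2
    change ∫ y, (dot ξ y * harmKernel Y (ℓ + 1) y x) * harmKernel Y ℓ y ξ ∂μ = _ at h2
    rw [if_neg (by omega), if_pos trivial, zero_add] at h2
    rw [if_pos trivial, if_neg (by omega), add_zero, hswap, h2, h'' ξ fun _ => rfl] at h1
    rw [← h1, harmKernel_comm Y _ ξ x]
    push_cast
    ring_nf
  have down : ∀ (ℓ : ℕ) (u v : Sph q → ℝ), IsSphHarm q (ℓ + 1 + 1) u →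
      IsSphHarm q (ℓ + 1 - 1) v →
      (∀ y, dot ξ y * harmKernel Y (ℓ + 1) y ξ = u y + v y) →
      v x = (1 - ℓ / (2 * ℓ + q - 1)) * harmKernel Y ℓ x ξ := by
    intro ℓ u v hu hv h
    obtain ⟨u', v', hu', hv', h0', h', h''⟩ :=
      (hY.isSphHarm_harmKernel ℓ x).exists_linear_mul_eq fun i => (ξ : Euc q) i
    have h1 := hrep (ℓ + 1) ℓ u v hu hv (by simp) x
    have h2 := hrep ℓ (ℓ + 1) u' v' hu' hv' h0' ξ
    simp only [← h] at h1
    simp only [← h'] at h2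
    change ∫ y, (dot ξ y * harmKernel Y ℓ y x) * harmKernel Y (ℓ + 1) y ξ ∂μ = _ at h2
    have h3 := h' ξ
    change dot ξ ξ * _ = _ at h3
    rw [dot_self, h'' ξ fun _ => rfl] at h3
    rw [if_pos trivial, if_neg (by omega), add_zero] at h2
    rw [if_neg (by omega), if_pos trivial, zero_add, hswap, h2] at h1
    rw [← h1, harmKernel_comm Y _ x ξ]
    linear_combination -h3
  constructor
  · obtain ⟨u, v, hu, hv, h0, h⟩ := hY.dot_mul_harmKernel (ℓ + 1) ξ
    rw [dot_comm, h, up (ℓ + 1) u v hu hv h0 h, down ℓ u v hu hv h]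
    push_cast
    ring_nf
  · obtain ⟨u, v, hu, hv, h0, h⟩ := hY.dot_mul_harmKernel 0 ξ
    rw [dot_comm, h, up 0 u v hu hv h0 h, h0 rfl]
    simp

lemma harmKernel_zero (hY : GoodBasis q μ d Y) (x ξ : Sph q) : harmKernel Y 0 x ξ = 1 := by
  obtain ⟨P, hP, -, hK⟩ := hY.isSphHarm_harmKernel 0 ξ
  obtain ⟨a, rfl⟩ : ∃ a, P = MvPolynomial.C a :=
    ⟨_, MvPolynomial.totalDegree_eq_zero_iff_eq_C.mp
      ((MvPolynomial.totalDegree_zero_iff_isHomogeneous _).mpr hP)⟩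
  simp only [MvPolynomial.eval_C] at hK
  have h1 : IsSphHarm q 0 fun _ => 1 :=
    ⟨1, MvPolynomial.isHomogeneous_one _ _, by simp, by simp⟩
  have := hY.integral_mul_harmKernel h1 0 ξ
  rw [hK]
  simpa [hK] using this

end GoodBasis

lemma zonal_rec (hq : 1 ≤ q) (t : ℝ) (ℓ : ℕ) :
    t * zonal q t (ℓ + 1) = (ℓ + 2) / (2 * ℓ + q + 3) * zonal q t (ℓ + 2) +
      (1 - ℓ / (2 * ℓ + q - 1)) * zonal q t ℓ := by
  have hq' : (1 : ℝ) ≤ q := by exact_mod_cast hq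
  rcases ℓ with _ | _ | ℓ
  · have h := gegU_rec q t 0
    simp only [zonal, gegU] at h ⊢
    field_simp
    simp
    ring
  · have h := gegU_rec q t 1
    rw [show (2 * ((0 + 1 : ℕ) : ℝ) + q - 1) = q + 1 by push_cast; ring]
    simp only [zonal, gegU] at h ⊢
    push_cast
    field_simp
    ring
  · have h1 := gegU_rec q t (ℓ + 2)
    have h2 := gegU_rec q t ℓ
    have e1 : (2 * ((ℓ : ℝ) + 1 + 1) + q - 1) = 2 * ℓ + q + 3 := by ring
    have e2 : (2 * ((ℓ : ℝ) + 1 + 1) + q + 3) = 2 * ℓ + q + 7 := by ring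
    simp only [zonal]
    push_cast at h1 h2 ⊢
    rw [e1, e2]
    have e3 : (ℓ + 2 + 2 : ℝ) ≠ 0 := by positivity
    have e4 : (ℓ + 2 : ℝ) ≠ 0 := by positivity
    have h1' : gegU q t (ℓ + 2 + 2) = ((2 * (ℓ + 2) + q + 3) * t * gegU q t (ℓ + 2 + 1) -
      (ℓ + 2 + 1 + q) * gegU q t (ℓ + 2)) / (ℓ + 2 + 2) := by field_simp; linarith
    have h2' : gegU q t ℓ = ((2 * ℓ + q + 3) * t * gegU q t (ℓ + 1) -
      (ℓ + 2) * gegU q t (ℓ + 2)) / (ℓ + 1 + q) := by field_simp; linarith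
    rw [show ℓ + 1 + 1 + 2 = ℓ + 2 + 2 from rfl, h1', show ℓ + 1 + 1 = ℓ + 2 from rfl, h2']
    have e5 : (ℓ + 1 + q : ℝ) ≠ 0 := by positivity
    field_simp
    ring

lemma GoodBasis.harmKernel_eq_zonal {μ : Measure (Sph q)} [IsProbabilityMeasure μ] {d : ℕ → ℕ}
    {Y : (ℓ : ℕ) → Fin (d ℓ) → Sph q → ℝ} (hq : 1 ≤ q) (hY : GoodBasis q μ d Y) (ℓ : ℕ)
    (x ξ : Sph q) : harmKernel Y ℓ x ξ = zonal q (dot x ξ) ℓ := by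
  induction ℓ using Nat.twoStepInduction with
  | zero => exact hY.harmKernel_zero x ξ
  | one =>
    have h := (hY.dot_mul_harmKernel_eq 0 x ξ).2
    rw [hY.harmKernel_zero] at h
    rw [zonal]
    field_simp at h
    linarith
  | more ℓ ih1 ih2 =>
    have h := (hY.dot_mul_harmKernel_eq ℓ x ξ).1
    rw [ih1, ih2, zonal_rec hq] at h
    have h1 : (ℓ + 2 : ℝ) / (2 * ℓ + q + 3) ≠ 0 := by positivity
    exact (mul_left_cancel₀ h1 (add_right_cancel h)).symm

lemma isSphHarm_one : IsSphHarm q 0 fun _ => 1 :=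
  ⟨1, MvPolynomial.isHomogeneous_one _ _, by simp, by simp⟩

lemma GoodH.eq_zero_of_lt {S : ℕ} {h : ℝ → ℝ} (hh : GoodH S h) {n ℓ : ℕ} (hn : 1 ≤ n)
    (hℓ : n < ℓ) : h (ℓ / n) = 0 := by
  refine hh.2.1 _ ?_
  rw [one_lt_div (by exact_mod_cast hn)]
  exact_mod_cast hℓ

namespace GoodBasis

variable {μ : Measure (Sph q)} {d : ℕ → ℕ} {Y : (ℓ : ℕ) → Fin (d ℓ) → Sph q → ℝ}

lemma continuous_harmKernel (hY : GoodBasis q μ d Y) (ℓ : ℕ) (x : Sph q) :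
    Continuous fun ξ => harmKernel Y ℓ x ξ := by
  simp only [harmKernel_comm Y ℓ x]
  exact (hY.isSphHarm_harmKernel ℓ x).continuous

lemma continuous_Phi (hY : GoodBasis q μ d Y) (h : ℝ → ℝ) (n : ℕ) (x : Sph q) :
    Continuous fun ξ => Phi d Y h n x ξ :=
  continuous_finsetSum _ fun ℓ _ => continuous_const.mul (hY.continuous_harmKernel ℓ x)

variable [IsProbabilityMeasure μ]

lemma Phi_eq (hq : 1 ≤ q) (hY : GoodBasis q μ d Y) (h : ℝ → ℝ) (n : ℕ) (x ξ : Sph q) :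
    Phi d Y h n x ξ = ∑ ℓ ∈ range (n + 1), h (ℓ / n) * zonal q (dot x ξ) ℓ :=
  sum_congr rfl fun ℓ _ => by rw [← hY.harmKernel_eq_zonal hq]; rfl

lemma integral_mul_harmKernel_right (hY : GoodBasis q μ d Y) {ℓ : ℕ} {f : Sph q → ℝ}
    (hf : IsSphHarm q ℓ f) (j : ℕ) (x : Sph q) :
    ∫ ξ, f ξ * harmKernel Y j x ξ ∂μ = if ℓ = j then f x else 0 := by
  simp only [harmKernel_comm Y j x]
  exact hY.integral_mul_harmKernel hf j x

lemma continuous_and_integral_coeff_geom_pow_mul (hq : 1 ≤ q) (hY : GoodBasis q μ d Y)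
    (x : Sph q) (a n : ℕ) :
    Continuous (fun ξ => PowerSeries.coeff n (geom ^ a * zonalSeries q (dot x ξ))) ∧
      ∫ ξ, PowerSeries.coeff n (geom ^ a * zonalSeries q (dot x ξ)) ∂μ =
        PowerSeries.coeff n (geom ^ a) := by
  induction a generalizing n with
  | zero =>
    simp only [pow_zero, one_mul, zonalSeries, PowerSeries.coeff_mk,
      ← hY.harmKernel_eq_zonal hq]
    refine ⟨hY.continuous_harmKernel n x, ?_⟩
    have := hY.integral_mul_harmKernel_right isSphHarm_one n x
    simp only [one_mul] at this
    rw [this, PowerSeries.coeff_one]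
    exact if_congr eq_comm rfl rfl
  | succ a ih =>
    simp only [pow_succ' geom, mul_assoc, coeff_geom_mul]
    refine ⟨continuous_finsetSum _ fun k _ => (ih k).1, ?_⟩
    rw [integral_finsetSum _ fun k _ => integrable_of_continuous μ (ih k).1]
    exact sum_congr rfl fun k _ => (ih k).2

/-- Uniform boundedness of the Lebesgue constants of the summability operators. -/
theorem exists_integral_abs_Phi_le (hq : 1 ≤ q) (hY : GoodBasis q μ d Y) {S : ℕ}
    (hS : q + 1 ≤ S) {h : ℝ → ℝ} (hh : GoodH S h) :
    ∃ c : ℝ, 0 ≤ c ∧ ∀ n : ℕ, 1 ≤ n → ∀ x : Sph q, ∫ ξ, |Phi d Y h n x ξ| ∂μ ≤ c := by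
  obtain ⟨c, hc⟩ := hh.diffBound (q + 1) (q + 1) le_rfl (q + 1 : ℕ)
  refine ⟨max c 0, le_max_right _ _, fun n hn x => le_max_of_le_left ?_⟩
  set H : ℕ → ℝ := fun k => h (k / n) with hH
  have h1 : ∀ ξ, |Phi d Y h n x ξ| ≤ ∑ ℓ ∈ range (n + 1), |(fwdDiff 1)^[q + 2] H ℓ| *
      PowerSeries.coeff ℓ (geom ^ (q + 2) * zonalSeries q (dot x ξ)) := by
    intro ξ
    have h2 := sum_mul_coeff_eq (zonalSeries q (dot x ξ)) H (n + 1)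
      (fun ℓ hℓ => hh.eq_zero_of_lt hn hℓ) (q + 2)
    rw [hY.Phi_eq hq]
    simp only [zonalSeries, PowerSeries.coeff_mk] at h2
    rw [h2, abs_mul, abs_pow, abs_neg, abs_one, one_pow, one_mul]
    refine (abs_sum_le_sum_abs _ _).trans (le_of_eq (sum_congr rfl fun ℓ _ => ?_))
    rw [abs_mul, ← zonalSeries,
      abs_of_nonneg (coeff_geom_pow_mul_zonalSeries_nonneg q (abs_dot_le_one x ξ) ℓ)]
  have hco := hY.continuous_and_integral_coeff_geom_pow_mul hq x (q + 2)
  have hi : ∀ ℓ ∈ range (n + 1), Integrable (fun ξ => |(fwdDiff 1)^[q + 2] H ℓ| *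
      PowerSeries.coeff ℓ (geom ^ (q + 2) * zonalSeries q (dot x ξ))) μ := fun ℓ _ =>
    (integrable_of_continuous μ (hco ℓ).1).const_mul _
  calc ∫ ξ, |Phi d Y h n x ξ| ∂μ
      ≤ ∫ ξ, ∑ ℓ ∈ range (n + 1), |(fwdDiff 1)^[q + 2] H ℓ| *
        PowerSeries.coeff ℓ (geom ^ (q + 2) * zonalSeries q (dot x ξ)) ∂μ :=
        integral_mono (integrable_of_continuous μ (hY.continuous_Phi h n x).abs)
          (integrable_finsetSum _ hi) h1
    _ = ∑ ℓ ∈ range (n + 1), |(fwdDiff 1)^[q + 2] H ℓ| *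
        PowerSeries.coeff ℓ (geom ^ (q + 2)) := by
        rw [integral_finsetSum _ hi]
        exact sum_congr rfl fun ℓ _ => by rw [integral_const_mul, (hco ℓ).2]
    _ ≤ c := by
        have h3 := hc n hn (n + 1)
        rw [show (((q + 1 : ℕ) : ℤ) - (min (0 + (q + 1)) S : ℕ)) = 0 by omega, zpow_zero,
          mul_one] at h3
        refine le_trans (sum_le_sum fun ℓ _ => ?_) h3
        rw [zpow_natCast, mul_comm, ← Function.iterate_succ_apply]
        exact mul_le_mul_of_nonneg_right (coeff_geom_pow_succ_le (q + 1) ℓ) (abs_nonneg _)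

end GoodBasis

lemma exists_le_one_sub_dot (x₀ : Sph q) {δ δ' : ℝ} (hδ : δ' < δ) :
    ∃ η : ℝ, 0 < η ∧ ∀ x ∈ cap x₀ δ', ∀ ξ ∉ cap x₀ δ, η ≤ 1 - dot x ξ := by
  have hc : Continuous fun x : Sph q => gdist x x₀ := by
    simp only [gdist, dot_comm _ x₀]
    exact Real.continuous_arccos.comp (continuous_dot_right x₀)
  obtain ⟨ε, hε, h⟩ := Metric.uniformContinuous_iff.mp
    (CompactSpace.uniformContinuous_of_continuous hc) (δ - δ') (by linarith)
  refine ⟨ε ^ 2 / 2, by positivity, fun x hx ξ hξ => ?_⟩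
  have hxξ : ε ≤ dist x ξ := by
    by_contra! hlt
    have h1 := (abs_lt.mp (Real.dist_eq _ _ ▸ h hlt)).1
    simp only [cap, Set.mem_ofPred_eq, not_le] at hx hξ
    linarith
  have h2 : dist x ξ ^ 2 = 2 - 2 * dot x ξ := by
    have h3 : dist x ξ = ‖(x : Euc q) - ξ‖ := by rw [Subtype.dist_eq, dist_eq_norm]
    rw [h3, EuclideanSpace.real_norm_sq_eq]
    have h4 := dot_self x
    have h5 := dot_self ξ
    simp only [dot] at h4 h5 ⊢
    calc ∑ i, ((x : Euc q) - ξ) i ^ 2 = ∑ i, (x : Euc q) i * (x : Euc q) i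
          + ∑ i, (ξ : Euc q) i * (ξ : Euc q) i - 2 * ∑ i, (x : Euc q) i * (ξ : Euc q) i := by
          rw [mul_sum, ← sum_add_distrib, ← sum_sub_distrib]
          exact sum_congr rfl fun i _ => by simp; ring
      _ = _ := by rw [h4, h5]; ring
  have h6 : ε ^ 2 ≤ dist x ξ ^ 2 := pow_le_pow_left₀ hε.le hxξ 2
  linarith

lemma GoodBasis.exists_abs_Phi_le_of_notMem_cap (hq : 1 ≤ q) {μ : Measure (Sph q)}
    [IsProbabilityMeasure μ] {d : ℕ → ℕ} {Y : (ℓ : ℕ) → Fin (d ℓ) → Sph q → ℝ}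
    (hY : GoodBasis q μ d Y) {S : ℕ} {h : ℝ → ℝ} (hh : GoodH S h) {r : ℝ}
    (hr : r ≤ (S : ℝ) - q) (x₀ : Sph q) {δ δ' : ℝ} (hδ : δ' < δ) :
    ∃ c : ℝ, 0 ≤ c ∧ ∀ n : ℕ, 1 ≤ n → ∀ x ∈ cap x₀ δ', ∀ ξ ∉ cap x₀ δ,
      |Phi d Y h n x ξ| ≤ c * (n : ℝ) ^ (-r) := by
  obtain ⟨η, hη, hηd⟩ := exists_le_one_sub_dot x₀ hδ
  obtain ⟨c, hc⟩ := exists_pow_mul_sum_zonal_le q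
    (fun n ℓ => if n = 0 then 0 else h (ℓ / n)) (S := S) (by
      intro n ℓ hℓ
      split_ifs with h0
      · rfl
      · exact hh.eq_zero_of_lt (Nat.one_le_iff_ne_zero.mpr h0) hℓ) (by
      intro J j hj i
      obtain ⟨c, hc⟩ := hh.diffBound J j hj i
      refine ⟨c, fun n hn N => ?_⟩
      simpa only [if_neg (Nat.one_le_iff_ne_zero.mp hn)] using hc n hn N)
  refine ⟨max c 0 / η ^ S, by positivity, fun n hn x hx ξ hξ => ?_⟩
  have h1 := hc n hn (dot x ξ) (abs_dot_le_one x ξ)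
  simp only [if_neg (Nat.one_le_iff_ne_zero.mp hn)] at h1
  rw [← hY.Phi_eq hq] at h1
  have h2 : η ^ S ≤ (1 - dot x ξ) ^ S := pow_le_pow_left₀ hη.le (hηd x hx ξ hξ) S
  have h3 : ((n : ℝ) ^ ((q : ℤ) - S)) ≤ (n : ℝ) ^ (-r) := by
    rw [← Real.rpow_intCast]
    refine Real.rpow_le_rpow_of_exponent_le (by exact_mod_cast hn) ?_
    push_cast
    linarith
  rw [div_mul_eq_mul_div, le_div_iff₀ (by positivity), mul_comm]
  calc η ^ S * |Phi d Y h n x ξ| ≤ (1 - dot x ξ) ^ S * |Phi d Y h n x ξ| :=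
        mul_le_mul_of_nonneg_right h2 (abs_nonneg _)
    _ ≤ c * (n : ℝ) ^ ((q : ℤ) - S) := h1
    _ ≤ max c 0 * (n : ℝ) ^ ((q : ℤ) - S) :=
        mul_le_mul_of_nonneg_right (le_max_left _ _) (by positivity)
    _ ≤ max c 0 * (n : ℝ) ^ (-r) := mul_le_mul_of_nonneg_left h3 (le_max_right _ _)

lemma IsSphHarm.inPi {ℓ : ℕ} {f : Sph q → ℝ} (hf : IsSphHarm q ℓ f) : InPi q ℓ f := by
  obtain ⟨P, hP, -, h⟩ := hf
  exact ⟨P, hP.totalDegree_le, h⟩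

namespace InPi

lemma mono {n m : ℕ} {f : Sph q → ℝ} (hf : InPi q n f) (h : n ≤ m) : InPi q m f := by
  obtain ⟨P, hP, h'⟩ := hf
  exact ⟨P, hP.trans h, h'⟩

lemma mul {n m : ℕ} {f g : Sph q → ℝ} (hf : InPi q n f) (hg : InPi q m g) :
    InPi q (n + m) fun x => f x * g x := by
  obtain ⟨P, hP, hfP⟩ := hf
  obtain ⟨Q, hQ, hgQ⟩ := hg
  exact ⟨P * Q, (MvPolynomial.totalDegree_mul P Q).trans (add_le_add hP hQ),
    fun x => by simp only [hfP, hgQ, map_mul]⟩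

lemma const (n : ℕ) (a : ℝ) : InPi q n fun _ => a :=
  ⟨MvPolynomial.C a, by simp, by simp⟩

lemma const_mul {n : ℕ} {f : Sph q → ℝ} (a : ℝ) (hf : InPi q n f) :
    InPi q n fun x => a * f x := by
  simpa using (const 0 a).mul hf

lemma sum {ι : Type*} {n : ℕ} (s : Finset ι) {f : ι → Sph q → ℝ}
    (hf : ∀ i ∈ s, InPi q n (f i)) : InPi q n fun x => ∑ i ∈ s, f i x := by
  choose! P hP hfP using hf
  refine ⟨∑ i ∈ s, P i, MvPolynomial.totalDegree_finsetSum_le hP, fun x => ?_⟩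
  rw [map_sum]
  exact sum_congr rfl fun i hi => hfP i hi x

end InPi

namespace GoodBasis

variable {μ : Measure (Sph q)} {d : ℕ → ℕ} {Y : (ℓ : ℕ) → Fin (d ℓ) → Sph q → ℝ}

lemma inPi_Phi (hY : GoodBasis q μ d Y) (h : ℝ → ℝ) (n : ℕ) (x : Sph q) :
    InPi q n fun ξ => Phi d Y h n x ξ := by
  refine InPi.sum _ fun ℓ hℓ => InPi.const_mul _ ?_
  have := hY.isSphHarm_harmKernel ℓ x
  simp only [harmKernel_comm Y ℓ _ x] at this
  exact this.inPi.mono (Nat.lt_succ_iff.mp (mem_range.mp hℓ))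

variable [IsProbabilityMeasure μ]

lemma sigmaStar_eq_sum (hY : GoodBasis q μ d Y) (h : ℝ → ℝ) (n : ℕ) {f : Sph q → ℝ}
    (hf : Continuous f) (x : Sph q) :
    sigmaStar μ d Y h n f x =
      ∑ ℓ ∈ range (n + 1), h (ℓ / n) * ∫ ξ, f ξ * harmKernel Y ℓ x ξ ∂μ := by
  simp only [sigmaStar, Phi, mul_sum]
  rw [integral_finsetSum]
  · refine sum_congr rfl fun ℓ _ => ?_
    rw [← integral_const_mul]
    refine integral_congr_ae (Filter.Eventually.of_forall fun ξ => ?_)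
    simp only [harmKernel, ← mul_sum]
    ring
  · intro ℓ _
    simp only [← mul_sum]
    exact integrable_of_continuous μ
      (hf.mul (continuous_const.mul (hY.continuous_harmKernel ℓ x)))

lemma exists_sigmaStar_eq_sum (hY : GoodBasis q μ d Y) (h : ℝ → ℝ) (n : ℕ) {f : Sph q → ℝ}
    (hf : Continuous f) : ∃ g : ℕ → Sph q → ℝ, (∀ ℓ, IsSphHarm q ℓ (g ℓ)) ∧
      sigmaStar μ d Y h n f = fun x => ∑ ℓ ∈ range (n + 1), g ℓ x := by
  refine ⟨fun ℓ x => ∑ k, (h (ℓ / n) * ∫ ξ, f ξ * Y ℓ k ξ ∂μ) * Y ℓ k x,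
    fun ℓ => IsSphHarm.sum_mul _ _ fun k => hY.1 ℓ k, funext fun x => ?_⟩
  rw [hY.sigmaStar_eq_sum h n hf]
  refine sum_congr rfl fun ℓ _ => ?_
  simp only [harmKernel, mul_sum]
  have hi : ∀ k ∈ univ, Integrable (fun ξ => f ξ * (Y ℓ k x * Y ℓ k ξ)) μ := fun k _ =>
    integrable_of_continuous μ (hf.mul (continuous_const.mul (hY.continuous ℓ k)))
  rw [integral_finsetSum _ hi, mul_sum]
  refine sum_congr rfl fun k _ => ?_
  simp only [mul_left_comm _ (Y ℓ k x), integral_const_mul]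
  ring

lemma inPi_sigmaStar (hY : GoodBasis q μ d Y) (h : ℝ → ℝ) (n : ℕ) {f : Sph q → ℝ}
    (hf : Continuous f) : InPi q n (sigmaStar μ d Y h n f) := by
  obtain ⟨g, hg, e⟩ := hY.exists_sigmaStar_eq_sum h n hf
  rw [e]
  exact InPi.sum _ fun ℓ hℓ => (hg ℓ).inPi.mono (Nat.lt_succ_iff.mp (mem_range.mp hℓ))

lemma sigmaStar_isSphHarm (hY : GoodBasis q μ d Y) {S : ℕ} {h : ℝ → ℝ} (hh : GoodH S h)
    {n ℓ : ℕ} (hn : 1 ≤ n) (hℓ : 2 * ℓ ≤ n) {f : Sph q → ℝ} (hf : IsSphHarm q ℓ f)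
    (x : Sph q) : sigmaStar μ d Y h n f x = f x := by
  rw [hY.sigmaStar_eq_sum h n hf.continuous]
  simp only [hY.integral_mul_harmKernel_right hf, mul_ite, mul_zero]
  rw [sum_ite_eq, if_pos (mem_range.mpr (by omega)), hh.1 _ (by positivity), one_mul]
  have : (0 : ℝ) < n := by exact_mod_cast hn
  rw [div_le_div_iff₀ this two_pos]
  exact_mod_cast (by omega : ℓ * 2 ≤ 1 * n)

lemma sigmaStar_sigmaStar (hY : GoodBasis q μ d Y) {S : ℕ} {h : ℝ → ℝ} (hh : GoodH S h)
    {n m : ℕ} (hn : 1 ≤ n) (hm : 2 * m ≤ n) {f : Sph q → ℝ} (hf : Continuous f) (x : Sph q) :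
    sigmaStar μ d Y h n (sigmaStar μ d Y h m f) x = sigmaStar μ d Y h m f x := by
  obtain ⟨g, hg, e⟩ := hY.exists_sigmaStar_eq_sum h m hf
  rw [e]
  simp only [sigmaStar, sum_mul]
  have hi : ∀ ℓ ∈ range (m + 1), Integrable (fun ξ => g ℓ ξ * Phi d Y h n x ξ) μ := fun ℓ _ =>
    integrable_of_continuous μ ((hg ℓ).continuous.mul (hY.continuous_Phi h n x))
  rw [integral_finsetSum _ hi]
  refine sum_congr rfl fun ℓ hℓ => ?_
  have := mem_range.mp hℓ
  exact hY.sigmaStar_isSphHarm hh hn (by omega) (hg ℓ) x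

lemma abs_sigmaStar_le (hY : GoodBasis q μ d Y) {h : ℝ → ℝ} {n : ℕ} {L B : ℝ} {x : Sph q}
    (hL : ∫ ξ, |Phi d Y h n x ξ| ∂μ ≤ L) {f : Sph q → ℝ} (hf : Continuous f) (hB : 0 ≤ B)
    (hfB : ∀ ξ, |f ξ| ≤ B) : |sigmaStar μ d Y h n f x| ≤ L * B := by
  have hc := hY.continuous_Phi h n x
  calc |sigmaStar μ d Y h n f x| ≤ ∫ ξ, |f ξ * Phi d Y h n x ξ| ∂μ := abs_integral_le_integral_abs
    _ ≤ ∫ ξ, B * |Phi d Y h n x ξ| ∂μ := by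
        refine integral_mono (integrable_of_continuous μ (hf.mul hc).abs)
          (integrable_of_continuous μ (continuous_const.mul hc.abs)) fun ξ => ?_
        simp only [abs_mul]
        exact mul_le_mul_of_nonneg_right (hfB ξ) (abs_nonneg _)
    _ ≤ L * B := by
        rw [integral_const_mul, mul_comm]
        exact mul_le_mul_of_nonneg_right hL hB

end GoodBasis

/-- The linear span of all spherical harmonics. -/
def harmSpan (q : ℕ) : Submodule ℝ (Sph q → ℝ) :=
  Submodule.span ℝ {f | ∃ ℓ, IsSphHarm q ℓ f}

lemma mul_coord_mem_harmSpan {f : Sph q → ℝ} (hf : f ∈ harmSpan q) (i : Fin (q + 1)) :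
    (fun x : Sph q => f x * (x : Euc q) i) ∈ harmSpan q := by
  induction hf using Submodule.span_induction with
  | mem f hf =>
    obtain ⟨ℓ, hf⟩ := hf
    obtain ⟨u, v, hu, hv, -, huv, -⟩ := hf.exists_linear_mul_eq (Pi.single i 1)
    have e : (fun x : Sph q => f x * (x : Euc q) i) = u + v := by
      funext x
      rw [Pi.add_apply, ← huv, mul_comm]
      simp [Pi.single_apply]
    rw [e]
    exact add_mem (Submodule.subset_span ⟨_, hu⟩) (Submodule.subset_span ⟨_, hv⟩)
  | zero =>
    simp only [Pi.zero_apply, zero_mul]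
    exact zero_mem (harmSpan q)
  | add f g _ _ hf hg =>
    simp only [Pi.add_apply, add_mul]
    exact add_mem hf hg
  | smul a f _ hf =>
    simp only [Pi.smul_apply, smul_eq_mul, mul_assoc]
    exact (harmSpan q).smul_mem a hf

lemma eval_mem_harmSpan (P : MvPolynomial (Fin (q + 1)) ℝ) :
    (fun x : Sph q => MvPolynomial.eval (fun i => (x : Euc q) i) P) ∈ harmSpan q := by
  induction P using MvPolynomial.induction_on with
  | C a =>
    refine Submodule.subset_span ⟨0, MvPolynomial.C a, MvPolynomial.isHomogeneous_C _ a, ?_,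
      fun x => rfl⟩
    simp
  | add P Q hP hQ =>
    simp only [map_add]
    exact add_mem hP hQ
  | mul_X P i hP =>
    simp only [map_mul, MvPolynomial.eval_X]
    exact mul_coord_mem_harmSpan hP i

lemma GoodBasis.exists_sigmaStar_eq_of_mem_harmSpan {μ : Measure (Sph q)}
    [IsProbabilityMeasure μ] {d : ℕ → ℕ} {Y : (ℓ : ℕ) → Fin (d ℓ) → Sph q → ℝ}
    (hY : GoodBasis q μ d Y) {S : ℕ} {h : ℝ → ℝ} (hh : GoodH S h) {f : Sph q → ℝ}
    (hf : f ∈ harmSpan q) :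
    Continuous f ∧ ∃ N : ℕ, ∀ n ≥ N, ∀ x, sigmaStar μ d Y h n f x = f x := by
  induction hf using Submodule.span_induction with
  | mem f hf =>
    obtain ⟨ℓ, hf⟩ := hf
    exact ⟨hf.continuous, 2 * ℓ + 1, fun n hn x =>
      hY.sigmaStar_isSphHarm hh (by omega) (by omega) hf x⟩
  | zero => exact ⟨continuous_const, 0, fun n _ x => by simp [sigmaStar]⟩
  | add f g _ _ hf hg =>
    obtain ⟨hfc, N, hN⟩ := hf
    obtain ⟨hgc, M, hM⟩ := hg
    refine ⟨hfc.add hgc, max N M, fun n hn x => ?_⟩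
    rw [Pi.add_apply, ← hN n (le_of_max_le_left hn) x, ← hM n (le_of_max_le_right hn) x]
    simp only [sigmaStar, Pi.add_apply, add_mul]
    have hc := hY.continuous_Phi h n x
    exact integral_add (integrable_of_continuous μ (hfc.mul hc))
      (integrable_of_continuous μ (hgc.mul hc))
  | smul a f _ hf =>
    obtain ⟨hfc, N, hN⟩ := hf
    refine ⟨hfc.const_smul a, N, fun n hn x => ?_⟩
    rw [Pi.smul_apply, ← hN n hn x]
    simp only [sigmaStar, Pi.smul_apply, smul_eq_mul, mul_assoc, integral_const_mul]

lemma exists_mem_harmSpan_near {f : Sph q → ℝ} (hf : Continuous f) {ε : ℝ} (hε : 0 < ε) :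
    ∃ g ∈ harmSpan q, ∀ x, |g x - f x| < ε := by
  let coord : Fin (q + 1) → C(Sph q, ℝ) := fun i => ⟨fun x => (x : Euc q) i, by fun_prop⟩
  have hsep : (MvPolynomial.aeval (R := ℝ) coord).range.SeparatesPoints := by
    intro x y hxy
    obtain ⟨i, hi⟩ : ∃ i, (x : Euc q) i ≠ (y : Euc q) i := by
      by_contra! h
      exact hxy (Subtype.ext (PiLp.ext h))
    exact ⟨coord i, ⟨coord i, ⟨MvPolynomial.X i, by simp⟩, rfl⟩, hi⟩
  obtain ⟨⟨g, P, hP⟩, hg⟩ :=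
    ContinuousMap.exists_mem_subalgebra_near_continuous_of_separatesPoints _ hsep f hf ε hε
  refine ⟨_, eval_mem_harmSpan P, fun x => ?_⟩
  have h1 : g x = MvPolynomial.eval (fun i => (x : Euc q) i) P := by
    rw [← hP]
    have h2 := MvPolynomial.comp_aeval_apply (R := ℝ) (f := coord)
      (ContinuousMap.evalAlgHom ℝ ℝ x) P
    exact h2
  rw [← h1]
  exact hg x

lemma GoodBasis.tendsto_sigmaStar {μ : Measure (Sph q)} [IsProbabilityMeasure μ]
    {d : ℕ → ℕ} {Y : (ℓ : ℕ) → Fin (d ℓ) → Sph q → ℝ} (hY : GoodBasis q μ d Y) {S : ℕ}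
    {h : ℝ → ℝ} (hh : GoodH S h) {L : ℝ}
    (hL : ∀ n : ℕ, 1 ≤ n → ∀ x : Sph q, ∫ ξ, |Phi d Y h n x ξ| ∂μ ≤ L) {f : Sph q → ℝ}
    (hf : Continuous f) (x : Sph q) :
    Filter.Tendsto (fun n => sigmaStar μ d Y h n f x) Filter.atTop (nhds (f x)) := by
  have hL0 : 0 ≤ L := (integral_nonneg fun ξ => abs_nonneg _).trans (hL 1 le_rfl x)
  rw [Metric.tendsto_atTop]
  intro ε hε
  obtain ⟨g, hg, hgf⟩ := exists_mem_harmSpan_near hf (show 0 < ε / (L + 2) by positivity)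
  obtain ⟨hgc, N, hN⟩ := hY.exists_sigmaStar_eq_of_mem_harmSpan hh hg
  refine ⟨max N 1, fun n hn => ?_⟩
  have h1 := hY.abs_sigmaStar_le (hL n (le_of_max_le_right hn) x) (hgc.sub hf)
    (by positivity) fun ξ => (hgf ξ).le
  have h2 : sigmaStar μ d Y h n (fun ξ => g ξ - f ξ) x = g x - sigmaStar μ d Y h n f x := by
    rw [← hN n (le_of_max_le_left hn) x]
    have hc := hY.continuous_Phi h n x
    simp only [sigmaStar, sub_mul]
    exact integral_sub (integrable_of_continuous μ (hgc.mul hc))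
      (integrable_of_continuous μ (hf.mul hc))
  change |sigmaStar μ d Y h n (fun ξ => g ξ - f ξ) x| ≤ _ at h1
  rw [h2] at h1
  rw [Real.dist_eq]
  have h3 := (hgf x).le
  calc |sigmaStar μ d Y h n f x - f x|
      = |(g x - f x) - (g x - sigmaStar μ d Y h n f x)| := by congr 1; ring
    _ ≤ ε / (L + 2) + L * (ε / (L + 2)) := (abs_sub _ _).trans (add_le_add h3 h1)
    _ = ε * ((L + 1) / (L + 2)) := by ring
    _ < ε := mul_lt_of_lt_one_right hε (by rw [div_lt_one (by positivity)]; linarith)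

lemma bddAbove_range_abs {f : Sph q → ℝ} (hf : Continuous f) :
    BddAbove (Set.range fun x => |f x|) :=
  (isCompact_range hf.abs).bddAbove

lemma abs_le_supNormOn {K : Set (Sph q)} {f : Sph q → ℝ} (hf : Continuous f) {x : Sph q}
    (hx : x ∈ K) : |f x| ≤ supNormOn K f := by
  obtain ⟨B, hB⟩ := bddAbove_range_abs hf
  have hB' : ∀ y, |f y| ≤ B := fun y => hB ⟨y, rfl⟩
  have hbdd : BddAbove (Set.range fun y => ⨆ _ : y ∈ K, |f y|) := by
    refine ⟨B, ?_⟩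
    rintro _ ⟨y, rfl⟩
    exact Real.iSup_le (fun _ => hB' y) ((abs_nonneg _).trans (hB' y))
  refine le_ciSup_of_le hbdd x ?_
  exact le_ciSup (f := fun _ : x ∈ K => |f x|) (Set.finite_range _).bddAbove hx

lemma supNormOn_nonneg (K : Set (Sph q)) (f : Sph q → ℝ) : 0 ≤ supNormOn K f :=
  Real.iSup_nonneg fun _ => Real.iSup_nonneg fun _ => abs_nonneg _

namespace GoodBasis

variable {μ : Measure (Sph q)} [IsProbabilityMeasure μ] {d : ℕ → ℕ}
  {Y : (ℓ : ℕ) → Fin (d ℓ) → Sph q → ℝ}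

lemma continuous_sigmaStar (hY : GoodBasis q μ d Y) (h : ℝ → ℝ) (n : ℕ) {f : Sph q → ℝ}
    (hf : Continuous f) : Continuous (sigmaStar μ d Y h n f) := by
  obtain ⟨g, hg, e⟩ := hY.exists_sigmaStar_eq_sum h n hf
  rw [e]
  exact continuous_finsetSum _ fun ℓ _ => (hg ℓ).continuous

lemma abs_le_and_abs_sigmaStar_sub_le (hY : GoodBasis q μ d Y) {h : ℝ → ℝ} {r : ℝ}
    {K : Set (Sph q)} {f : Sph q → ℝ} (hf : MemWrOn K μ d Y h r f)
    (hf1 : WrNormOn K μ d Y h r f = 1) :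
    (∀ x, |f x| ≤ 1) ∧ ∀ x ∈ K, ∀ n : ℕ,
      |sigmaStar μ d Y h (2 ^ (n + 1)) f x - sigmaStar μ d Y h (2 ^ n) f x| ≤
        ((2 : ℝ) ^ (-r)) ^ (n + 1) := by
  have h0 : ∀ n, 0 ≤ WrSeqOn K μ d Y h r f n := fun n =>
    mul_nonneg (by positivity) (supNormOn_nonneg _ _)
  have h1 : 0 ≤ ⨆ n, WrSeqOn K μ d Y h r f n := Real.iSup_nonneg h0
  have h2 : 0 ≤ supNorm f := Real.iSup_nonneg fun _ => abs_nonneg _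
  rw [WrNormOn] at hf1
  constructor
  · intro x
    have h3 : |f x| ≤ supNorm f := le_ciSup (bddAbove_range_abs hf.1) x
    linarith
  · intro x hx n
    have h3 : WrSeqOn K μ d Y h r f n ≤ 1 := (le_ciSup hf.2 n).trans (by linarith)
    have h4 := abs_le_supNormOn (((hY.continuous_sigmaStar h (2 ^ (n + 1)) hf.1).sub
      (hY.continuous_sigmaStar h (2 ^ n) hf.1))) hx
    simp only [Pi.sub_apply] at h4
    have h5 : ((2 : ℝ) ^ (-r)) ^ (n + 1) = ((2 : ℝ) ^ (((n : ℝ) + 1) * r))⁻¹ := by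
      rw [← Real.rpow_natCast, ← Real.rpow_mul two_pos.le, ← Real.rpow_neg two_pos.le]
      congr 1
      push_cast
      ring
    rw [h5]
    refine h4.trans ?_
    rw [← one_div, le_div_iff₀' (by positivity)]
    exact h3

/-- Functions of class `W_r(K)` are approximated by polynomials of degree `n` at the rate
`n^{-r}` on `K`, boundedly on the whole sphere. -/
lemma exists_polynomial_approx (hY : GoodBasis q μ d Y) {S : ℕ} {h : ℝ → ℝ} (hh : GoodH S h)
    {L : ℝ} (hL0 : 0 ≤ L) (hL : ∀ n : ℕ, 1 ≤ n → ∀ x : Sph q, ∫ ξ, |Phi d Y h n x ξ| ∂μ ≤ L)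
    {r : ℝ} (hr : 0 < r) (K : Set (Sph q)) :
    ∃ A : ℝ, 0 ≤ A ∧ ∀ f : Sph q → ℝ, MemWrOn K μ d Y h r f → WrNormOn K μ d Y h r f = 1 →
      ∀ n : ℕ, 1 ≤ n → ∃ P : Sph q → ℝ, InPi q n P ∧
        (∀ x, sigmaStar μ d Y h n P x = P x) ∧ (∀ x, |f x - P x| ≤ A) ∧
        ∀ x ∈ K, |f x - P x| ≤ A * (n : ℝ) ^ (-r) := by
  set ρ : ℝ := 2 ^ (-r) with hρ
  have hρ0 : 0 < ρ := by positivity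
  have hρ1 : ρ < 1 := Real.rpow_lt_one_of_one_lt_of_neg one_lt_two (by linarith)
  have h1ρ : 0 < 1 - ρ := by linarith
  refine ⟨max (1 + L) (ρ / (1 - ρ) * (ρ ^ 2)⁻¹), by positivity, fun f hf hf1 n hn => ?_⟩
  obtain ⟨hfb, hfd⟩ := hY.abs_le_and_abs_sigmaStar_sub_le hf hf1
  rcases hn.eq_or_lt with rfl | hn
  · refine ⟨fun _ => 0, InPi.const _ _, by simp [sigmaStar], fun x => ?_, fun x _ => ?_⟩
    · simpa using Or.inl ((hfb x).trans (by linarith))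
    · simpa using Or.inl ((hfb x).trans (by linarith))
  set N := Nat.log 2 n - 1 with hN
  have hlog : 1 ≤ Nat.log 2 n := Nat.log_pos one_lt_two hn
  have hN1 : 2 * 2 ^ N ≤ n := by
    rw [← pow_succ', hN, Nat.sub_add_cancel hlog]
    exact Nat.pow_log_le_self 2 (by omega)
  have hN2 : n ≤ 2 ^ (N + 2) := by
    have := Nat.lt_pow_succ_log_self one_lt_two n
    rw [show N + 2 = (Nat.log 2 n).succ by omega]
    exact this.le
  refine ⟨sigmaStar μ d Y h (2 ^ N) f, (hY.inPi_sigmaStar h _ hf.1).mono (by omega),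
    hY.sigmaStar_sigmaStar hh (by omega) hN1 hf.1, fun x => ?_, fun x hx => ?_⟩
  · have h1 := hY.abs_sigmaStar_le (hL (2 ^ N) Nat.one_le_two_pow x) hf.1 zero_le_one hfb
    refine le_max_of_le_left ((abs_sub _ _).trans ?_)
    linarith [hfb x]
  · have ht : Filter.Tendsto (fun k : ℕ => sigmaStar μ d Y h (2 ^ k) f x) Filter.atTop
        (nhds (f x)) := (hY.tendsto_sigmaStar hh hL hf.1 x).comp
      (tendsto_pow_atTop_atTop_of_one_lt one_lt_two)
    have h1 := dist_le_of_le_geometric_of_tendsto ρ ρ hρ1 (fun k => by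
      rw [dist_comm, Real.dist_eq, ← pow_succ']
      exact hfd x hx k) ht N
    rw [dist_comm, Real.dist_eq] at h1
    have h2 : ρ ^ (N + 2) ≤ (n : ℝ) ^ (-r) := by
      have h3 : ρ ^ (N + 2) = ((2 : ℝ) ^ (N + 2)) ^ (-r) := by
        rw [hρ, ← Real.rpow_natCast, ← Real.rpow_natCast, ← Real.rpow_mul two_pos.le,
          ← Real.rpow_mul two_pos.le, mul_comm]
      rw [h3]
      exact Real.rpow_le_rpow_of_nonpos (by exact_mod_cast (by omega : 0 < n))
        (by exact_mod_cast hN2) (by linarith)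
    calc |f x - sigmaStar μ d Y h (2 ^ N) f x| ≤ ρ * ρ ^ N / (1 - ρ) := h1
      _ = ρ / (1 - ρ) * (ρ ^ 2)⁻¹ * ρ ^ (N + 2) := by
          rw [pow_add]
          field_simp
      _ ≤ _ := mul_le_mul (le_max_right _ _) h2 (by positivity) (by positivity)

end GoodBasis

lemma MZQuad.sigmaOp_eq_sigmaStar {μ : Measure (Sph q)} [IsProbabilityMeasure μ] {d : ℕ → ℕ}
    {Y : (ℓ : ℕ) → Fin (d ℓ) → Sph q → ℝ} (hY : GoodBasis q μ d Y) {m : ℕ}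
    {C : Finset (Sph q)} {w : Sph q → ℝ} {c₀ : ℝ} (hC : MZQuad q μ m C w c₀) (h : ℝ → ℝ)
    {n : ℕ} (hnm : n ≤ m) {P : Sph q → ℝ} (hP : InPi q n P) (x : Sph q) :
    sigmaOp d Y h n C w P x = sigmaStar μ d Y h n P x := by
  rw [sigmaStar, ← hC.1 _ ((hP.mul (hY.inPi_Phi h n x)).mono (by omega))]
  exact sum_congr rfl fun ξ _ => mul_assoc _ _ _

lemma MZQuad.sum_abs_le {μ : Measure (Sph q)} {m : ℕ} {C : Finset (Sph q)} {w : Sph q → ℝ}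
    {c₀ : ℝ} (hC : MZQuad q μ m C w c₀) {P : Sph q → ℝ} (hP : InPi q (2 * m) P) :
    ∑ ξ ∈ C, |w ξ| * |P ξ| ≤ c₀ * ∫ x, |P x| ∂μ := by
  simpa using hC.2 P hP 1 le_rfl

end Sphere

/-- Local approximation on concentric caps `K' ⊂ K` :
`‖f − σ_n(C,W;h;f)‖_{∞,K'} ≤ c n^{-r}` for `f ∈ W_r(K)`, `‖f‖_{W_r(K)} = 1`. -/
theorem statement8 (q S : ℕ) (hq : 1 ≤ q) (hSq : q ≤ S) (h : ℝ → ℝ) (hh : GoodH S h)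
    (μ : Measure (Sph q)) (hμ : IsProbabilityMeasure μ) (hrot : RotInvariant q μ)
    (d : ℕ → ℕ) (Y : (ℓ : ℕ) → Fin (d ℓ) → Sph q → ℝ) (hY : GoodBasis q μ d Y)
    (r : ℝ) (hr : 0 < r) (hrS : r ≤ (S : ℝ) - (q : ℝ))
    (c₀ : ℝ) (hc₀ : 0 < c₀)
    (x₀ : Sph q) (δ δ' : ℝ) (hδ' : 0 < δ') (hδ : δ' < δ) :
    ∃ c : ℝ, 0 < c ∧ ∀ m : ℕ, 1 ≤ m → ∀ (C : Finset (Sph q)) (w : Sph q → ℝ),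
      MZQuad q μ m C w c₀ → ∀ f : Sph q → ℝ,
        MemWrOn (cap x₀ δ) μ d Y h r f → WrNormOn (cap x₀ δ) μ d Y h r f = 1 →
        ∀ n : ℕ, 1 ≤ n → n ≤ m → ∀ x ∈ cap x₀ δ',
          |f x - sigmaOp d Y h n C w f x| ≤ c * (n : ℝ) ^ (-r) := by
  have := hμ
  have hS : q + 1 ≤ S := by
    have h1 : (q : ℝ) < S := by linarith
    exact_mod_cast h1
  obtain ⟨L, hL0, hL⟩ := hY.exists_integral_abs_Phi_le hq hS hh
  obtain ⟨E, hE0, hE⟩ := hY.exists_abs_Phi_le_of_notMem_cap hq hh hrS x₀ hδ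
  obtain ⟨A, hA0, hA⟩ := hY.exists_polynomial_approx hh hL0 hL hr (cap x₀ δ)
  refine ⟨A * (1 + c₀ * L + c₀ * E) + 1, by positivity, ?_⟩
  intro m _ C w hC f hf hf1 n hn hnm x hx
  obtain ⟨P, hP, hPP, hfP, hfPK⟩ := hA f hf hf1 n hn
  have hxK : x ∈ cap x₀ δ := le_trans (show gdist x x₀ ≤ δ' from hx) hδ.le
  have hR : 0 < (n : ℝ) ^ (-r) := Real.rpow_pos_of_pos (by exact_mod_cast hn) _
  set R := (n : ℝ) ^ (-r)
  have hw : ∑ ξ ∈ C, |w ξ| ≤ c₀ := by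
    simpa using hC.sum_abs_le (InPi.const (2 * m) 1)
  have hwPhi : ∑ ξ ∈ C, |w ξ| * |Phi d Y h n x ξ| ≤ c₀ * L :=
    (hC.sum_abs_le ((hY.inPi_Phi h n x).mono (by omega))).trans
      (mul_le_mul_of_nonneg_left (hL n hn x) hc₀.le)
  have hpt : ∀ ξ, |P ξ - f ξ| * |Phi d Y h n x ξ| ≤ A * R * |Phi d Y h n x ξ| + A * R * E := by
    intro ξ
    rw [abs_sub_comm]
    by_cases hξ : ξ ∈ cap x₀ δ
    · have h1 := mul_le_mul_of_nonneg_right (hfPK ξ hξ) (abs_nonneg (Phi d Y h n x ξ))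
      have h2 : 0 ≤ A * R * E := by positivity
      linarith
    · have h1 := mul_le_mul (hfP ξ) (hE n hn x hx ξ hξ) (abs_nonneg _) hA0
      have h2 : 0 ≤ A * R * |Phi d Y h n x ξ| := by positivity
      linarith
  have hsub : P x - sigmaOp d Y h n C w f x =
      ∑ ξ ∈ C, w ξ * (P ξ - f ξ) * Phi d Y h n x ξ := by
    rw [← hPP x, ← hC.sigmaOp_eq_sigmaStar hY h hnm hP x]
    simp only [sigmaOp, mul_sub, sub_mul, sum_sub_distrib]
  have hsum : |P x - sigmaOp d Y h n C w f x| ≤ A * R * (c₀ * L) + A * R * E * c₀ := by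
    rw [hsub]
    calc |∑ ξ ∈ C, w ξ * (P ξ - f ξ) * Phi d Y h n x ξ|
        ≤ ∑ ξ ∈ C, |w ξ| * (A * R * |Phi d Y h n x ξ| + A * R * E) := by
          refine (abs_sum_le_sum_abs _ _).trans (sum_le_sum fun ξ _ => ?_)
          rw [abs_mul, abs_mul, mul_assoc]
          exact mul_le_mul_of_nonneg_left (hpt ξ) (abs_nonneg _)
      _ = A * R * ∑ ξ ∈ C, |w ξ| * |Phi d Y h n x ξ| + A * R * E * ∑ ξ ∈ C, |w ξ| := by
          rw [mul_sum, mul_sum, ← sum_add_distrib]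
          exact sum_congr rfl fun ξ _ => by ring
      _ ≤ _ := add_le_add (mul_le_mul_of_nonneg_left hwPhi (by positivity))
          (mul_le_mul_of_nonneg_left hw (by positivity))
  calc |f x - sigmaOp d Y h n C w f x|
      ≤ |f x - P x| + |P x - sigmaOp d Y h n C w f x| := abs_sub_le _ _ _
    _ ≤ A * R + (A * R * (c₀ * L) + A * R * E * c₀) := add_le_add (hfPK x hxK) hsum
    _ ≤ _ := by linarith [hR]

end SD
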